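/- arXiv:1707.02113 — 9 statements merged into one kernel-verified Lean document; each statement's English description precedes it below -/
import Mathlib

section
/- For every ε>0 there exists a constant K_ε>0 such that the following holds. Let C ≥ 1, let T be a real number with 1 ≤ T ≤ C/2, and let s, m, n be positive integers with gcd(gcd(m,n), s) = 1. Then Σ_{c} τ(c)·gcd(m,n,c)^{1/2}·c^{-1/2} ≤ K_ε·(C·m·n·s)^ε·C^{-1/2}·( gcd(m,n)^{1/2} + T/s ), where the sum runs over all positive integers c divisible by s with either C−T ≤ c ≤ C or 2C ≤ c ≤ 2C+2T. -/
open Finset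

lemma succ_le_mul_two_pow_rpow {δ : ℝ} (hδ : 0 < δ) (a : ℕ) :
    (a + 1 : ℝ) ≤ (1 + 1 / (δ * Real.log 2)) * ((2 : ℝ) ^ a) ^ δ := by
  have hlog : 0 < Real.log 2 := Real.log_pos (by norm_num)
  have hexp : ((2 : ℝ) ^ a) ^ δ = Real.exp (a * (δ * Real.log 2)) := by
    rw [Real.rpow_def_of_pos (by positivity), Real.log_pow]
    congr 1
    ring
  have hbound := Real.add_one_le_exp (a * (δ * Real.log 2))
  have hpos : 0 < δ * Real.log 2 := by positivity
  rw [hexp]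
  calc (a + 1 : ℝ) ≤ (1 + 1 / (δ * Real.log 2)) * (a * (δ * Real.log 2) + 1) := by
        have : (1 + 1 / (δ * Real.log 2)) * (a * (δ * Real.log 2) + 1)
            = a + 1 + a * (δ * Real.log 2) + 1 / (δ * Real.log 2) := by
          field_simp
          ring
        rw [this]
        have : 0 ≤ (a : ℝ) * (δ * Real.log 2) := by positivity
        have : 0 ≤ 1 / (δ * Real.log 2) := by positivity
        linarith
    _ ≤ _ := by gcongr

lemma succ_le_pow_rpow {δ : ℝ} (hδ : 0 < δ) {p : ℕ} (hp : (2 : ℝ) ^ (1 / δ) ≤ p) (a : ℕ) :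
    (a + 1 : ℝ) ≤ ((p : ℝ) ^ a) ^ δ := by
  have hp' : (2 : ℝ) ≤ (p : ℝ) ^ δ := by
    calc (2 : ℝ) = ((2 : ℝ) ^ (1 / δ)) ^ δ := by
          rw [← Real.rpow_mul (by norm_num), one_div_mul_cancel hδ.ne', Real.rpow_one]
      _ ≤ _ := by gcongr
  rw [← Real.rpow_natCast, ← Real.rpow_mul (by positivity), mul_comm,
    Real.rpow_mul (by positivity), Real.rpow_natCast]
  calc (a + 1 : ℝ) ≤ (2 : ℝ) ^ a := by exact_mod_cast Nat.lt_two_pow_self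
    _ ≤ _ := by gcongr

/-- The divisor bound `τ(n) ≪ n ^ δ`. -/
lemma exists_card_divisors_le_mul_rpow {δ : ℝ} (hδ : 0 < δ) :
    ∃ K : ℝ, 0 < K ∧ ∀ n : ℕ, 0 < n → (n.divisors.card : ℝ) ≤ K * (n : ℝ) ^ δ := by
  have hlog : 0 < Real.log 2 := Real.log_pos (by norm_num)
  set M : ℝ := 1 + 1 / (δ * Real.log 2)
  have hM1 : 1 ≤ M := le_add_of_nonneg_right (by positivity)
  set P : ℕ := ⌈(2 : ℝ) ^ (1 / δ)⌉₊
  refine ⟨M ^ P, by positivity, fun n hn => ?_⟩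
  have hfactor : ∀ p ∈ n.primeFactors, ((n.factorization p + 1 : ℕ) : ℝ) ≤
      (if p < P then M else 1) * ((p : ℝ) ^ n.factorization p) ^ δ := by
    intro p hp
    push_cast
    split_ifs with h
    · have h2 : (2 : ℝ) ≤ p := by exact_mod_cast (Nat.prime_of_mem_primeFactors hp).two_le
      refine (succ_le_mul_two_pow_rpow hδ _).trans ?_
      gcongr
    · rw [one_mul]
      exact succ_le_pow_rpow hδ ((Nat.le_ceil _).trans (by exact_mod_cast not_lt.mp h)) _
  have hprod : ∏ p ∈ n.primeFactors, ((p : ℝ) ^ n.factorization p) ^ δ = (n : ℝ) ^ δ := by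
    rw [Real.finsetProd_rpow _ _ (fun _ _ => by positivity)]
    congr 1
    exact_mod_cast Nat.prod_factorization_pow_eq_self hn.ne'
  have hcard : ∏ p ∈ n.primeFactors, (if p < P then M else 1) ≤ M ^ P := by
    rw [← Finset.prod_filter, Finset.prod_const]
    refine pow_le_pow_right₀ hM1 ?_
    calc _ ≤ (Finset.range P).card := Finset.card_le_card fun p hp => by
          simpa using (Finset.mem_filter.mp hp).2
      _ = P := Finset.card_range P
  rw [Nat.card_divisors hn.ne', Nat.cast_prod]
  calc _ ≤ ∏ p ∈ n.primeFactors,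
        (if p < P then M else 1) * ((p : ℝ) ^ n.factorization p) ^ δ :=
        Finset.prod_le_prod (fun _ _ => by positivity) hfactor
    _ ≤ _ := by
        rw [Finset.prod_mul_distrib, hprod]
        gcongr

/-- An interval of length `L` contains at most `L / q + 1` multiples of `q`. -/
lemma card_multiples_le_of_mem_Icc {S : Finset ℕ} {q : ℕ} (hq : 0 < q) {a L : ℝ} (hL : 0 ≤ L)
    (hS : ∀ c ∈ S, q ∣ c ∧ a ≤ c ∧ (c : ℝ) ≤ a + L) :
    (S.card : ℝ) ≤ L / q + 1 := by
  have hq' : (0 : ℝ) < q := by exact_mod_cast hq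
  have hcard : S.card ≤ (Finset.Icc ⌈a / q⌉ ⌊(a + L) / q⌋).card := by
    refine Finset.card_le_card_of_injOn (fun c => ((c / q : ℕ) : ℤ)) ?_ ?_
    · intro c hc
      obtain ⟨⟨k, rfl⟩, h1, h2⟩ := hS c hc
      push_cast at h1 h2
      simp only [Finset.coe_Icc, Set.mem_Icc, Nat.mul_div_cancel_left k hq]
      refine ⟨Int.ceil_le.mpr ?_, Int.le_floor.mpr ?_⟩
      · rw [div_le_iff₀ hq']
        push_cast
        linarith
      · rw [le_div_iff₀ hq']
        push_cast
        linarith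
    · intro c hc d hd hcd
      have hcd' : c / q = d / q := Int.ofNat_inj.mp hcd
      rw [← Nat.div_mul_cancel (hS c hc).1, hcd', Nat.div_mul_cancel (hS d hd).1]
  have hlen : (((⌊(a + L) / q⌋ + 1 - ⌈a / q⌉).toNat : ℤ) : ℝ) ≤ L / q + 1 := by
    rw [Int.toNat_eq_max, Int.cast_max]
    refine max_le ?_ (by push_cast; positivity)
    have h1 := Int.floor_le ((a + L) / q)
    have h2 := Int.le_ceil (a / q)
    have h3 : (a + L) / q = a / q + L / q := add_div _ _ _
    push_cast
    linarith
  rw [Int.card_Icc] at hcard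
  exact le_trans (by exact_mod_cast hcard) hlen

/-- The sum of `gcd(g, c) ^ (1 / 2)` over multiples `c` of `s` in an interval of length `L`. -/
lemma sum_gcd_rpow_half_le {S : Finset ℕ} {g s : ℕ} (hg : 0 < g) (hs : 0 < s)
    (hgs : Nat.gcd g s = 1) {a L : ℝ} (hL : 0 ≤ L)
    (hS : ∀ c ∈ S, s ∣ c ∧ a ≤ c ∧ (c : ℝ) ≤ a + L) :
    ∑ c ∈ S, (Nat.gcd g c : ℝ) ^ ((1 : ℝ) / 2) ≤
      g.divisors.card * ((g : ℝ) ^ ((1 : ℝ) / 2) + L / s) := by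
  have hs' : (0 : ℝ) < s := by exact_mod_cast hs
  calc ∑ c ∈ S, (Nat.gcd g c : ℝ) ^ ((1 : ℝ) / 2)
      ≤ ∑ c ∈ S, ∑ d ∈ g.divisors, (if d ∣ c then (d : ℝ) ^ ((1 : ℝ) / 2) else 0) := by
        refine Finset.sum_le_sum fun c _ => ?_
        have h := Finset.single_le_sum (s := g.divisors)
          (f := fun d : ℕ => if d ∣ c then (d : ℝ) ^ ((1 : ℝ) / 2) else 0)
          (fun d _ => by positivity)
          (Nat.mem_divisors.mpr ⟨Nat.gcd_dvd_left g c, hg.ne'⟩)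
        simpa only [if_pos (Nat.gcd_dvd_right g c)] using h
    _ = ∑ d ∈ g.divisors, ((S.filter (d ∣ ·)).card : ℝ) * (d : ℝ) ^ ((1 : ℝ) / 2) := by
        rw [Finset.sum_comm]
        refine Finset.sum_congr rfl fun d _ => ?_
        rw [← Finset.sum_filter, Finset.sum_const, nsmul_eq_mul]
    _ ≤ ∑ d ∈ g.divisors, ((g : ℝ) ^ ((1 : ℝ) / 2) + L / s) := by
        refine Finset.sum_le_sum fun d hd => ?_
        have hdg := Nat.dvd_of_mem_divisors hd
        have hd0 : 0 < d := Nat.pos_of_mem_divisors hd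
        have hd1 : (1 : ℝ) ≤ d := by exact_mod_cast hd0
        have hcop : Nat.Coprime d s := Nat.Coprime.coprime_dvd_left hdg hgs
        have hcard := card_multiples_le_of_mem_Icc (S := S.filter (d ∣ ·))
          (Nat.mul_pos hd0 hs) hL fun c hc => by
            obtain ⟨hcS, hdc⟩ := Finset.mem_filter.mp hc
            exact ⟨hcop.mul_dvd_of_dvd_of_dvd hdc (hS c hcS).1, (hS c hcS).2⟩
        have hle : (d : ℝ) ^ ((1 : ℝ) / 2) ≤ d := by
          simpa using Real.rpow_le_rpow_of_exponent_le hd1 (by norm_num : (1 : ℝ) / 2 ≤ 1)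
        have hdg' : (d : ℝ) ≤ g := by exact_mod_cast Nat.le_of_dvd hg hdg
        calc _ ≤ (L / (d * s : ℕ) + 1) * (d : ℝ) ^ ((1 : ℝ) / 2) := by gcongr
          _ = (d : ℝ) ^ ((1 : ℝ) / 2) + L / (d * s) * (d : ℝ) ^ ((1 : ℝ) / 2) := by
              push_cast
              ring
          _ ≤ (g : ℝ) ^ ((1 : ℝ) / 2) + L / (d * s) * d := by gcongr
          _ = _ := by
              field_simp
    _ = _ := by rw [Finset.sum_const, nsmul_eq_mul]

theorem sharp_cutoff_error_bound :
    ∀ ε : ℝ, 0 < ε → ∃ K : ℝ, 0 < K ∧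
      ∀ (C T : ℝ) (s m n : ℕ), 1 ≤ C → 1 ≤ T → T ≤ C / 2 → 0 < s → 0 < m → 0 < n →
        Nat.gcd (Nat.gcd m n) s = 1 →
        ∑ c ∈ (Finset.Icc 1 ⌊2 * C + 2 * T⌋₊).filter
            (fun c => s ∣ c ∧
              ((C - T ≤ (c : ℝ) ∧ (c : ℝ) ≤ C) ∨ (2 * C ≤ (c : ℝ) ∧ (c : ℝ) ≤ 2 * C + 2 * T))),
          ((c.divisors.card : ℝ) * (Nat.gcd (Nat.gcd m n) c : ℝ) ^ ((1:ℝ)/2)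
            * (c : ℝ) ^ (-(1:ℝ)/2)) ≤
        K * ((C * m * n * s) ^ ε) * C ^ (-(1:ℝ)/2) * ((Nat.gcd m n : ℝ) ^ ((1:ℝ)/2) + T / s) := by
  intro ε hε
  obtain ⟨D, hD, hdiv⟩ := exists_card_divisors_le_mul_rpow hε
  refine ⟨3 * D ^ 2 * 3 ^ ε * (1 / 2) ^ (-(1 : ℝ) / 2), by positivity, ?_⟩
  intro C T s m n hC hT hTC hs hm hn hgs
  set g := Nat.gcd m n
  have hg : 0 < g := Nat.gcd_pos_of_pos_left n hm
  have hgle : (g : ℝ) ≤ m * n * s := by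
    have h : g ≤ m * n * s :=
      Nat.le_of_dvd (by positivity) (((Nat.gcd_dvd_left m n).mul_right n).mul_right s)
    exact_mod_cast h
  set S := (Finset.Icc 1 ⌊2 * C + 2 * T⌋₊).filter (fun c => s ∣ c ∧
    ((C - T ≤ (c : ℝ) ∧ (c : ℝ) ≤ C) ∨ (2 * C ≤ (c : ℝ) ∧ (c : ℝ) ≤ 2 * C + 2 * T)))
  set A : ℝ := (1 / 2) ^ (-(1 : ℝ) / 2) * C ^ (-(1 : ℝ) / 2) with hA
  set R : ℝ := (g : ℝ) ^ ((1 : ℝ) / 2) + T / s with hR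
  have hterm : ∀ c ∈ S, (c.divisors.card : ℝ) * (Nat.gcd g c : ℝ) ^ ((1 : ℝ) / 2)
      * (c : ℝ) ^ (-(1 : ℝ) / 2) ≤
      D * (3 * C) ^ ε * A * (Nat.gcd g c : ℝ) ^ ((1 : ℝ) / 2) := by
    intro c hc
    obtain ⟨hcI, _, hw⟩ := Finset.mem_filter.mp hc
    have hc0 : 0 < c := (Finset.mem_Icc.mp hcI).1
    have hlow : 1 / 2 * C ≤ c := by rcases hw with h | h <;> linarith
    have hupp : (c : ℝ) ≤ 3 * C := by rcases hw with h | h <;> linarith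
    have hτ : (c.divisors.card : ℝ) ≤ D * (3 * C) ^ ε := (hdiv c hc0).trans (by gcongr)
    have hinv : (c : ℝ) ^ (-(1 : ℝ) / 2) ≤ A := by
      rw [hA, ← Real.mul_rpow (by norm_num) (by positivity)]
      exact Real.rpow_le_rpow_of_nonpos (by positivity) hlow (by norm_num)
    calc _ ≤ D * (3 * C) ^ ε * (Nat.gcd g c : ℝ) ^ ((1 : ℝ) / 2) * A := by gcongr
      _ = _ := by ring
  have hgcd : ∑ c ∈ S, (Nat.gcd g c : ℝ) ^ ((1 : ℝ) / 2) ≤ g.divisors.card * (3 * R) := by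
    rw [← Finset.sum_filter_add_sum_filter_not S (fun c : ℕ => (c : ℝ) ≤ C)]
    have h1 := sum_gcd_rpow_half_le (S := S.filter (fun c : ℕ => (c : ℝ) ≤ C)) hg hs hgs
      (a := C - T) (L := T) (by linarith) fun c hc => by
        obtain ⟨hcS, hcC⟩ := Finset.mem_filter.mp hc
        obtain ⟨_, hsc, hw⟩ := Finset.mem_filter.mp hcS
        exact ⟨hsc, by rcases hw with h | h <;> linarith, by linarith⟩
    have h2 := sum_gcd_rpow_half_le (S := S.filter (fun c : ℕ => ¬ (c : ℝ) ≤ C)) hg hs hgs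
      (a := 2 * C) (L := 2 * T) (by linarith) fun c hc => by
        obtain ⟨hcS, hcC⟩ := Finset.mem_filter.mp hc
        obtain ⟨_, hsc, hw⟩ := Finset.mem_filter.mp hcS
        exact ⟨hsc, hw.resolve_left fun h => hcC h.2⟩
    have hsqrt : 0 ≤ (g : ℝ) ^ ((1 : ℝ) / 2) := by positivity
    calc _ ≤ _ := add_le_add h1 h2
      _ = g.divisors.card * (3 * R - (g : ℝ) ^ ((1 : ℝ) / 2)) := by
          rw [hR]
          ring
      _ ≤ _ := by
          gcongr
          linarith
  have hR0 : 0 ≤ R := by positivity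
  calc _ ≤ ∑ c ∈ S, D * (3 * C) ^ ε * A * (Nat.gcd g c : ℝ) ^ ((1 : ℝ) / 2) :=
        Finset.sum_le_sum hterm
    _ = D * (3 * C) ^ ε * A * ∑ c ∈ S, (Nat.gcd g c : ℝ) ^ ((1 : ℝ) / 2) := by
        rw [Finset.mul_sum]
    _ ≤ D * (3 * C) ^ ε * A * (D * (m * n * s : ℝ) ^ ε * (3 * R)) := by
        refine mul_le_mul_of_nonneg_left (hgcd.trans ?_) (by positivity)
        refine mul_le_mul_of_nonneg_right ((hdiv g hg).trans ?_) (by positivity)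
        gcongr
    _ = _ := by
        rw [Real.mul_rpow (by norm_num) (by positivity : (0 : ℝ) ≤ C),
          show C * m * n * s = C * (m * n * s) by ring,
          Real.mul_rpow (by positivity : (0 : ℝ) ≤ C) (by positivity), hA]
        ring
end

section
/- Let K be a nonnegative integer, let A ≤ B be real numbers, and let G, H : [A,B] → ℝ be continuously differentiable functions such that G has a zero in [A,B] and the set {x ∈ [A,B] : H'(x) = 0} has at most K elements. Then sup_{x∈[A,B]} |G(x)·H(x)| + ∫_A^B |(G·H)'(x)| dx ≤ (2K+4) · ( ∫_A^B |G'(x)| dx ) · ( sup_{x∈[A,B]} |H(x)| ). -/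
open Set

theorem intervalIntegral_abs_deriv_le_of_forall_ne_zero
    {a b M : ℝ} (hab : a ≤ b) {f f' : ℝ → ℝ}
    (hf : ContinuousOn f (Set.Icc a b))
    (hderiv : ∀ x ∈ Set.Ioo a b, HasDerivAt f (f' x) x)
    (hf' : ContinuousOn f' (Set.Icc a b))
    (hM : ∀ x ∈ Set.Icc a b, |f x| ≤ M)
    (hne : ∀ x ∈ Set.Ioo a b, f' x ≠ 0) :
    (∫ x in a..b, |f' x|) ≤ 2 * M := by
  have hint : IntervalIntegrable f' MeasureTheory.volume a b :=
    hf'.intervalIntegrable_of_Icc hab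
  have hftc := intervalIntegral.integral_eq_sub_of_hasDerivAt_of_le hab hf hderiv hint
  have ha := abs_le.1 (hM a (Set.left_mem_Icc.2 hab))
  have hb := abs_le.1 (hM b (Set.right_mem_Icc.2 hab))
  have hcont : ContinuousOn f' (Set.Ioo a b) := hf'.mono Set.Ioo_subset_Icc_self
  have hsign : (∀ x ∈ Set.Ioo a b, 0 ≤ f' x) ∨ ∀ x ∈ Set.Ioo a b, f' x ≤ 0 := by
    by_contra! h
    obtain ⟨⟨x, hx, hx0⟩, y, hy, hy0⟩ := h
    obtain ⟨z, hz, hz0⟩ :=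
      isPreconnected_Ioo.intermediate_value hx hy hcont ⟨hx0.le, hy0.le⟩
    exact hne z hz hz0
  rcases hsign with h | h
  · have : (∫ x in a..b, |f' x|) = ∫ x in a..b, f' x :=
      intervalIntegral.integral_congr_Ioo_of_le hab fun x hx => abs_of_nonneg (h x hx)
    linarith
  · have : (∫ x in a..b, |f' x|) = -∫ x in a..b, f' x := by
      rw [← intervalIntegral.integral_neg]
      exact intervalIntegral.integral_congr_Ioo_of_le hab
        fun x hx => abs_of_nonpos (h x hx)
    linarith

theorem intervalIntegral_abs_deriv_le_of_zeros_subset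
    {f f' : ℝ → ℝ} {M : ℝ} (S : Finset ℝ) {a b : ℝ} (hab : a ≤ b)
    (hf : ContinuousOn f (Set.Icc a b))
    (hderiv : ∀ x ∈ Set.Ioo a b, HasDerivAt f (f' x) x)
    (hf' : ContinuousOn f' (Set.Icc a b))
    (hM : ∀ x ∈ Set.Icc a b, |f x| ≤ M)
    (hS : ∀ x ∈ Set.Ioo a b, f' x = 0 → x ∈ S) :
    (∫ x in a..b, |f' x|) ≤ 2 * ((S.card : ℝ) + 1) * M := by
  induction S using Finset.strongInduction generalizing a b with
  | H S ih =>
  have hM0 : 0 ≤ M := (abs_nonneg _).trans (hM a (Set.left_mem_Icc.2 hab))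
  by_cases hne : ∀ x ∈ Set.Ioo a b, f' x ≠ 0
  · have h := intervalIntegral_abs_deriv_le_of_forall_ne_zero hab hf hderiv hf' hM hne
    have : 0 ≤ (S.card : ℝ) * M := by positivity
    linarith
  push Not at hne
  obtain ⟨c, hc, hc0⟩ := hne
  have hcS := hS c hc hc0
  have hl : Set.Icc a c ⊆ Set.Icc a b := Set.Icc_subset_Icc_right hc.2.le
  have hr : Set.Icc c b ⊆ Set.Icc a b := Set.Icc_subset_Icc_left hc.1.le
  have hl' : Set.Ioo a c ⊆ Set.Ioo a b := Set.Ioo_subset_Ioo_right hc.2.le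
  have hr' : Set.Ioo c b ⊆ Set.Ioo a b := Set.Ioo_subset_Ioo_left hc.1.le
  have h₁ := ih (S.filter (· < c))
    (Finset.filter_ssubset.2 ⟨c, hcS, lt_irrefl c⟩) hc.1.le (hf.mono hl)
    (fun x hx => hderiv x (hl' hx)) (hf'.mono hl) (fun x hx => hM x (hl hx))
    (fun x hx h0 => Finset.mem_filter.2 ⟨hS x (hl' hx) h0, hx.2⟩)
  have h₂ := ih (S.filter (c < ·))
    (Finset.filter_ssubset.2 ⟨c, hcS, lt_irrefl c⟩) hc.2.le (hf.mono hr)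
    (fun x hx => hderiv x (hr' hx)) (hf'.mono hr) (fun x hx => hM x (hr hx))
    (fun x hx h0 => Finset.mem_filter.2 ⟨hS x (hr' hx) h0, hx.1⟩)
  have hcard : (S.filter (· < c)).card + (S.filter (c < ·)).card + 1 ≤ S.card := by
    rw [← Finset.card_union_of_disjoint
      (Finset.disjoint_filter.2 fun x _ h h' => lt_asymm h h'), Nat.succ_le_iff]
    refine Finset.card_lt_card (Finset.ssubset_iff_subset_ne.2
      ⟨Finset.union_subset (Finset.filter_subset _ _) (Finset.filter_subset _ _), fun h => ?_⟩)
    rw [← h] at hcS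
    simp at hcS
  have hcard' : ((S.filter (· < c)).card : ℝ) + (S.filter (c < ·)).card + 1 ≤ S.card := by
    exact_mod_cast hcard
  rw [← intervalIntegral.integral_add_adjacent_intervals
    ((hf'.mono hl).abs.intervalIntegrable_of_Icc hc.1.le)
    ((hf'.mono hr).abs.intervalIntegrable_of_Icc hc.2.le)]
  nlinarith [mul_le_mul_of_nonneg_right hcard' hM0]

theorem abs_sub_le_intervalIntegral_abs_deriv
    {f f' : ℝ → ℝ} {a b x y : ℝ}
    (hf : ContinuousOn f (Set.Icc a b))
    (hderiv : ∀ x ∈ Set.Ioo a b, HasDerivAt f (f' x) x)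
    (hf' : ContinuousOn f' (Set.Icc a b))
    (hx : x ∈ Set.Icc a b) (hy : y ∈ Set.Icc a b) :
    |f y - f x| ≤ ∫ t in a..b, |f' t| := by
  wlog hxy : x ≤ y generalizing x y
  · rw [abs_sub_comm]
    exact this hy hx (le_of_not_ge hxy)
  have hsub : Set.Icc x y ⊆ Set.Icc a b := Set.Icc_subset_Icc hx.1 hy.2
  rw [← intervalIntegral.integral_eq_sub_of_hasDerivAt_of_le hxy (hf.mono hsub)
    (fun t ht => hderiv t (Set.Ioo_subset_Ioo hx.1 hy.2 ht))
    ((hf'.mono hsub).intervalIntegrable_of_Icc hxy)]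
  refine (intervalIntegral.abs_integral_le_integral_abs hxy).trans ?_
  exact intervalIntegral.integral_mono_interval hx.1 hxy hy.2
    (Filter.Eventually.of_forall fun t => abs_nonneg (f' t))
    (hf'.abs.intervalIntegrable_of_Icc (hx.1.trans hx.2))

theorem product_variation_estimate
    (K : ℕ) (A B : ℝ) (hAB : A ≤ B) (G G' H H' : ℝ → ℝ)
    (hG : ∀ x ∈ Set.Icc A B, HasDerivWithinAt G (G' x) (Set.Icc A B) x)
    (hH : ∀ x ∈ Set.Icc A B, HasDerivWithinAt H (H' x) (Set.Icc A B) x)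
    (hG' : ContinuousOn G' (Set.Icc A B))
    (hH' : ContinuousOn H' (Set.Icc A B))
    (hGzero : ∃ x ∈ Set.Icc A B, G x = 0)
    (hfin : {x ∈ Set.Icc A B | H' x = 0}.Finite)
    (hcard : {x ∈ Set.Icc A B | H' x = 0}.ncard ≤ K) :
    (⨆ x : Set.Icc A B, |G x * H x|) + (∫ x in A..B, |G' x * H x + G x * H' x|) ≤
      (2 * (K : ℝ) + 4) * (∫ x in A..B, |G' x|) * ⨆ x : Set.Icc A B, |H x| := by
  have hGc : ContinuousOn G (Set.Icc A B) := fun x hx => (hG x hx).continuousWithinAt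
  have hHc : ContinuousOn H (Set.Icc A B) := fun x hx => (hH x hx).continuousWithinAt
  have hGd : ∀ x ∈ Set.Ioo A B, HasDerivAt G (G' x) x := fun x hx =>
    (hG x (Set.Ioo_subset_Icc_self hx)).hasDerivAt (Icc_mem_nhds hx.1 hx.2)
  have hHd : ∀ x ∈ Set.Ioo A B, HasDerivAt H (H' x) x := fun x hx =>
    (hH x (Set.Ioo_subset_Icc_self hx)).hasDerivAt (Icc_mem_nhds hx.1 hx.2)
  set V := ∫ x in A..B, |G' x| with hV
  set M := ⨆ x : Set.Icc A B, |H x|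
  have hbdd : BddAbove (Set.range fun x : Set.Icc A B => |H x|) := by
    have h := isCompact_Icc.bddAbove_image hHc.abs
    rwa [Set.image_eq_range] at h
  have hHM : ∀ x ∈ Set.Icc A B, |H x| ≤ M := fun x hx => le_ciSup hbdd ⟨x, hx⟩
  have hGV : ∀ x ∈ Set.Icc A B, |G x| ≤ V := by
    intro x hx
    obtain ⟨z, hz, hz0⟩ := hGzero
    simpa [hz0] using abs_sub_le_intervalIntegral_abs_deriv hGc hGd hG' hz hx
  have hA : A ∈ Set.Icc A B := Set.left_mem_Icc.2 hAB
  have hM0 : 0 ≤ M := (abs_nonneg _).trans (hHM A hA)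
  have hV0 : 0 ≤ V := (abs_nonneg _).trans (hGV A hA)
  have hsup : (⨆ x : Set.Icc A B, |G x * H x|) ≤ V * M := by
    have : Nonempty (Set.Icc A B) := ⟨⟨A, hA⟩⟩
    refine ciSup_le fun x => ?_
    rw [abs_mul]
    exact mul_le_mul (hGV x x.2) (hHM x x.2) (abs_nonneg _) hV0
  have hHvar : (∫ x in A..B, |H' x|) ≤ 2 * ((K : ℝ) + 1) * M := by
    refine (intervalIntegral_abs_deriv_le_of_zeros_subset hfin.toFinset hAB hHc hHd hH' hHM
      fun x hx h0 => hfin.mem_toFinset.2 ⟨Set.Ioo_subset_Icc_self hx, h0⟩).trans ?_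
    rw [Set.ncard_eq_toFinset_card _ hfin] at hcard
    gcongr
  have hiG := hG'.abs.intervalIntegrable_of_Icc (μ := MeasureTheory.volume) hAB
  have hiH := hH'.abs.intervalIntegrable_of_Icc (μ := MeasureTheory.volume) hAB
  have hprod : (∫ x in A..B, |G' x * H x + G x * H' x|) ≤
      V * M + V * ∫ x in A..B, |H' x| := by
    rw [hV, ← intervalIntegral.integral_mul_const, ← hV, ← intervalIntegral.integral_const_mul,
      ← intervalIntegral.integral_add (hiG.mul_const M) (hiH.const_mul V)]
    refine intervalIntegral.integral_mono_on hAB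
      (((hG'.mul hHc).add (hGc.mul hH')).abs.intervalIntegrable_of_Icc hAB)
      ((hiG.mul_const M).add (hiH.const_mul V)) fun x hx => ?_
    refine (abs_add_le _ _).trans ?_
    rw [abs_mul, abs_mul]
    exact add_le_add (mul_le_mul_of_nonneg_left (hHM x hx) (abs_nonneg _))
      (mul_le_mul_of_nonneg_right (hGV x hx) (abs_nonneg _))
  nlinarith [mul_le_mul_of_nonneg_left hHvar hV0]
end

section
/- Let X > 0, let β be a nonzero real number, and let g : ℝ → ℝ be a continuously differentiable function with support contained in [X/3, 2X] satisfying ∫_ℝ |g'(x)| dx ≤ 1. Then |∫_0^∞ e^{iβx} · g(x)/x dx| ≤ min{ log 6, 6/(X·|β|) }. -/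
open Set

/-- To the right of a zero, a `C¹` function is bounded by its total variation. -/
lemma abs_le_integral_abs_deriv {g : ℝ → ℝ} (hg : ContDiff ℝ 1 g)
    (hint : MeasureTheory.Integrable fun x => |deriv g x|) {a x : ℝ} (hax : a ≤ x)
    (ha : g a = 0) : |g x| ≤ ∫ t : ℝ, |deriv g t| := by
  have hcont : Continuous (deriv g) := hg.continuous_deriv le_rfl
  have hFTC : ∫ t in a..x, deriv g t = g x - g a :=
    intervalIntegral.integral_deriv_eq_sub
      (fun t _ => (hg.differentiable one_ne_zero).differentiableAt) (hcont.intervalIntegrable _ _)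
  have hgx : g x = ∫ t in a..x, deriv g t := by rw [hFTC, ha, sub_zero]
  calc |g x| ≤ ∫ t in a..x, |deriv g t| := by
        rw [hgx]; exact intervalIntegral.abs_integral_le_integral_abs hax
    _ = ∫ t in Ioc a x, |deriv g t| := intervalIntegral.integral_of_le hax
    _ ≤ ∫ t : ℝ, |deriv g t| :=
        MeasureTheory.setIntegral_le_integral hint (Filter.Eventually.of_forall fun _ => abs_nonneg _)

/-- A continuous function supported in `[a, b]` vanishes at `a` and `b`. -/
lemma eq_zero_of_support_subset_Icc {g : ℝ → ℝ} (hg : Continuous g) {a b : ℝ}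
    (hsupp : Function.support g ⊆ Icc a b) : g a = 0 ∧ g b = 0 := by
  have hsub : Function.support g ⊆ Ioo a b := by
    rw [← interior_Icc]
    exact interior_maximal hsupp (isOpen_ne_fun hg continuous_const)
  constructor <;> by_contra h
  · exact lt_irrefl _ (hsub h).1
  · exact lt_irrefl _ (hsub h).2

lemma norm_exp_I_mul_ofReal_mul_ofReal (β x : ℝ) :
    ‖Complex.exp (Complex.I * β * x)‖ = 1 := by
  rw [show Complex.I * β * x = ((β * x : ℝ) : ℂ) * Complex.I by push_cast; ring]
  exact Complex.norm_exp_ofReal_mul_I _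

lemma norm_integral_exp_mul_div_le_log {g : ℝ → ℝ} {a b : ℝ} (β : ℝ) (ha : 0 < a) (hab : a ≤ b)
    (hbound : ∀ x ∈ Icc a b, |g x| ≤ 1) :
    ‖∫ x in a..b, Complex.exp (Complex.I * β * x) * (g x / x)‖ ≤ Real.log (b / a) := by
  have h0 : (0 : ℝ) ∉ uIcc a b := by
    rw [uIcc_of_le hab]; exact fun h => absurd h.1 (not_le.2 ha)
  rw [← integral_inv h0]
  refine intervalIntegral.norm_integral_le_of_norm_le hab
    (Filter.Eventually.of_forall fun x hx => ?_)
    (intervalIntegral.intervalIntegrable_inv (fun x hx h => h0 (h ▸ hx)) continuousOn_id)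
  have hx0 : 0 < x := ha.trans hx.1
  rw [norm_mul, norm_exp_I_mul_ofReal_mul_ofReal, one_mul, norm_div, Complex.norm_real,
    Complex.norm_real, Real.norm_eq_abs, Real.norm_eq_abs, abs_of_pos hx0, ← one_div]
  gcongr
  exact hbound x ⟨hx.1.le, hx.2⟩

lemma norm_integral_exp_mul_div_le_div {g : ℝ → ℝ} {a b β : ℝ} (hg : ContDiff ℝ 1 g)
    (ha : 0 < a) (hab : a ≤ b) (hβ : β ≠ 0) (hga : g a = 0) (hgb : g b = 0)
    (hbound : ∀ x ∈ Icc a b, |g x| ≤ 1) (hvar : ∫ x in a..b, |deriv g x| ≤ 1) :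
    ‖∫ x in a..b, Complex.exp (Complex.I * β * x) * (g x / x)‖ ≤ 2 / (a * |β|) := by
  have hcont : Continuous (deriv g) := hg.continuous_deriv le_rfl
  have hpos : ∀ x ∈ uIcc a b, 0 < x := fun x hx => by
    rw [uIcc_of_le hab] at hx; exact ha.trans_le hx.1
  have hβ' : (Complex.I * β : ℂ) ≠ 0 :=
    mul_ne_zero Complex.I_ne_zero (Complex.ofReal_ne_zero.2 hβ)
  set u' : ℝ → ℝ := fun x => (deriv g x * x - g x * 1) / x ^ 2 with hu'
  set v : ℝ → ℂ := fun x => Complex.exp (Complex.I * β * x) / (Complex.I * β) with hv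
  have hderiv_u : ∀ x ∈ uIcc a b,
      HasDerivAt (fun y : ℝ => ((g y / y : ℝ) : ℂ)) (u' x : ℂ) x := fun x hx =>
    (((hg.differentiable one_ne_zero).differentiableAt.hasDerivAt.div
      (hasDerivAt_id x) (hpos x hx).ne').ofReal_comp)
  have hderiv_v : ∀ x ∈ uIcc a b, HasDerivAt v (Complex.exp (Complex.I * β * x)) x := by
    intro x _
    have h := (((hasDerivAt_id x).ofReal_comp.const_mul (Complex.I * β)).cexp).div_const
      (Complex.I * β)
    refine HasDerivAt.congr_deriv h ?_
    rw [Complex.ofReal_one, mul_one, mul_div_assoc, div_self hβ', mul_one]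
    rfl
  have hu'_cont : ContinuousOn u' (uIcc a b) :=
    ContinuousOn.div
      ((hcont.mul continuous_id).sub (hg.continuous.mul continuous_const)).continuousOn
      (continuous_pow 2).continuousOn fun x hx => pow_ne_zero 2 (hpos x hx).ne'
  have hparts := intervalIntegral.integral_mul_deriv_eq_deriv_mul hderiv_u hderiv_v
    (Complex.continuous_ofReal.comp_continuousOn hu'_cont).intervalIntegrable
    (Continuous.intervalIntegrable (by fun_prop) _ _)
  have hinv_sq_cont : ContinuousOn (fun x : ℝ => (x ^ 2)⁻¹) (uIcc a b) :=
    (continuous_pow 2).continuousOn.inv₀ fun x hx => pow_ne_zero 2 (hpos x hx).ne'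
  have hinv_sq : ∫ x in a..b, (x ^ 2)⁻¹ = a⁻¹ - b⁻¹ := by
    rw [intervalIntegral.integral_eq_sub_of_hasDerivAt (f := fun x : ℝ => -x⁻¹)
      (fun x hx => ?_) hinv_sq_cont.intervalIntegrable]
    · ring
    · exact (hasDerivAt_inv (hpos x hx).ne').neg.congr_deriv (neg_neg _)
  have hI : ∫ x in a..b, Complex.exp (Complex.I * β * x) * (g x / x) =
      -∫ x in a..b, (u' x : ℂ) * v x := by
    simp only [hga, hgb, zero_div, Complex.ofReal_zero, zero_mul, sub_zero, zero_sub] at hparts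
    rw [← hparts]
    refine intervalIntegral.integral_congr fun x _ => ?_
    push_cast
    ring
  have hint₁ : IntervalIntegrable (fun x => a⁻¹ * |deriv g x|) MeasureTheory.volume a b :=
    (hcont.abs.const_mul _).intervalIntegrable _ _
  have hle : ‖∫ x in a..b, (u' x : ℂ) * v x‖ ≤
      ∫ x in a..b, (a⁻¹ * |deriv g x| + (x ^ 2)⁻¹) * |β|⁻¹ := by
    refine intervalIntegral.norm_integral_le_of_norm_le hab
      (Filter.Eventually.of_forall fun x hx => ?_)
      ((hint₁.add hinv_sq_cont.intervalIntegrable).mul_const _)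
    have hx0 : 0 < x := ha.trans hx.1
    have hnv : ‖v x‖ = |β|⁻¹ := by
      simp [hv, norm_exp_I_mul_ofReal_mul_ofReal]
    rw [norm_mul, hnv, Complex.norm_real, Real.norm_eq_abs]
    gcongr
    have hsplit : u' x = x⁻¹ * deriv g x - g x * (x ^ 2)⁻¹ := by
      simp only [hu']; field_simp
    calc |u' x| ≤ |x⁻¹ * deriv g x| + |g x * (x ^ 2)⁻¹| := hsplit ▸ abs_sub _ _
      _ = x⁻¹ * |deriv g x| + |g x| * (x ^ 2)⁻¹ := by
          rw [abs_mul, abs_mul, abs_of_pos (inv_pos.2 hx0),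
            abs_of_pos (inv_pos.2 (pow_pos hx0 2))]
      _ ≤ a⁻¹ * |deriv g x| + 1 * (x ^ 2)⁻¹ := by
          gcongr
          · exact hx.1.le
          · exact hbound x ⟨hx.1.le, hx.2⟩
      _ = a⁻¹ * |deriv g x| + (x ^ 2)⁻¹ := by rw [one_mul]
  rw [hI, norm_neg]
  refine hle.trans ?_
  rw [intervalIntegral.integral_mul_const,
    intervalIntegral.integral_add hint₁ hinv_sq_cont.intervalIntegrable,
    intervalIntegral.integral_const_mul, hinv_sq]
  have hb : 0 < b⁻¹ := inv_pos.2 (ha.trans_le hab)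
  calc (a⁻¹ * (∫ x in a..b, |deriv g x|) + (a⁻¹ - b⁻¹)) * |β|⁻¹
      ≤ (a⁻¹ * 1 + a⁻¹) * |β|⁻¹ := by
        gcongr
        linarith
    _ = 2 / (a * |β|) := by
        rw [div_eq_mul_inv, mul_inv]; ring

theorem oscillatory_integral_basic_bound
    (X β : ℝ) (hX : 0 < X) (hβ : β ≠ 0) (g : ℝ → ℝ)
    (hg : ContDiff ℝ 1 g)
    (hsupp : Function.support g ⊆ Set.Icc (X / 3) (2 * X))
    (hg' : ∫ x : ℝ, |deriv g x| ≤ 1) :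
    ‖∫ x in Set.Ioi (0 : ℝ), Complex.exp (Complex.I * β * x) * (g x / x)‖ ≤
      min (Real.log 6) (6 / (X * |β|)) := by
  have ha : 0 < X / 3 := by positivity
  have hab : X / 3 ≤ 2 * X := by linarith
  obtain ⟨hga, hgb⟩ := eq_zero_of_support_subset_Icc hg.continuous hsupp
  have hcomp : HasCompactSupport g :=
    HasCompactSupport.of_support_subset_isCompact isCompact_Icc hsupp
  have hint : MeasureTheory.Integrable fun x => |deriv g x| :=
    ((hg.continuous_deriv le_rfl).integrable_of_hasCompactSupport hcomp.deriv).abs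
  have hbound : ∀ x ∈ Icc (X / 3) (2 * X), |g x| ≤ 1 := fun x hx =>
    (abs_le_integral_abs_deriv hg hint hx.1 hga).trans hg'
  have hvar : ∫ x in (X / 3)..(2 * X), |deriv g x| ≤ 1 := by
    rw [intervalIntegral.integral_of_le hab]
    exact (MeasureTheory.setIntegral_le_integral hint
      (Filter.Eventually.of_forall fun _ => abs_nonneg _)).trans hg'
  have hrestrict : ∫ x in Ioi (0 : ℝ), Complex.exp (Complex.I * β * x) * (g x / x) =
      ∫ x in (X / 3)..(2 * X), Complex.exp (Complex.I * β * x) * (g x / x) := by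
    rw [intervalIntegral.integral_of_le hab]
    refine MeasureTheory.setIntegral_eq_of_subset_of_forall_sdiff_eq_zero measurableSet_Ioi
      (fun x hx => ha.trans hx.1) fun x hx => ?_
    have hgx : g x = 0 := by
      by_contra h
      obtain ⟨h₁, h₂⟩ := hsupp h
      exact hx.2 ⟨lt_of_le_of_ne h₁ fun h₃ => h (h₃ ▸ hga), h₂⟩
    simp [hgx]
  rw [hrestrict]
  refine le_min ?_ ?_
  · refine (norm_integral_exp_mul_div_le_log β ha hab hbound).trans_eq ?_
    congr 1
    field_simp
    norm_num
  · refine (norm_integral_exp_mul_div_le_div hg ha hab hβ hga hgb hbound hvar).trans_eq ?_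
    have : |β| ≠ 0 := abs_ne_zero.2 hβ
    field_simp
    norm_num
end

section
/- There exists an absolute constant K > 0 such that for all X > 0 and all α ∈ [0,1], ∫_0^{2π} min{ 1, 1/(X·|sin ξ + α|) } dξ ≤ K·(1 + |log X|) / ( 1 + X^{1/2} + (1−α²)^{1/2}·X ). -/
open Real MeasureTheory intervalIntegral in
/-- Translating an even nonnegative kernel can at most double its integral over `[0, π]`. -/
lemma integral_comp_sub_le_two_mul_of_even {G : ℝ → ℝ} (hG : Continuous G) (h0 : ∀ v, 0 ≤ G v)
    (heven : ∀ v, G (-v) = G v) {φ : ℝ} (hφ : φ ∈ Set.Icc 0 π) :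
    ∫ u in (0:ℝ)..π, G (u - φ) ≤ 2 * ∫ v in (0:ℝ)..π, G v := by
  obtain ⟨h1, h2⟩ := hφ
  rw [intervalIntegral.integral_comp_sub_right (fun v => G v) φ]
  have hi : ∀ a b, IntervalIntegrable G volume a b := fun a b => hG.intervalIntegrable a b
  have hneg : ∫ v in (-π)..0, G v = ∫ v in (0:ℝ)..π, G v := by
    have h := intervalIntegral.integral_comp_neg (a := 0) (b := π) (fun v => G v)
    simp only [heven, neg_zero] at h
    exact h.symm
  calc ∫ v in (0 - φ)..(π - φ), G v ≤ ∫ v in (-π)..π, G v :=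
        integral_mono_interval (by linarith) (by linarith) (by linarith)
          (Filter.Eventually.of_forall h0) (hi _ _)
    _ = 2 * ∫ v in (0:ℝ)..π, G v := by
        rw [← integral_add_adjacent_intervals (hi (-π) 0) (hi 0 π), hneg]; ring

open Real in
lemma div_five_le_sin {t : ℝ} (h0 : 0 ≤ t) (h1 : t ≤ 3 * π / 4) : t / 5 ≤ sin t := by
  have hp := pi_lt_d2
  have hinv : 1 / 2 ≤ 2 / π := by rw [div_le_div_iff₀ (by norm_num) pi_pos]; linarith
  rcases le_total t (π / 2) with h | h
  · have := mul_le_sin h0 h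
    nlinarith
  · have h3 := mul_le_sin (x := π - t) (by linarith) (by linarith)
    rw [sin_pi_sub] at h3
    have h4 : 2 / π * (π / 4) ≤ 2 / π * (π - t) := by
      apply mul_le_mul_of_nonneg_left _ (by positivity)
      linarith
    have h5 : 2 / π * (π / 4) = 1 / 2 := by field_simp; norm_num
    linarith

open Real in
lemma mul_abs_sub_le_abs_cos_sub_cos {u φ : ℝ} (hu : u ∈ Set.Icc 0 π)
    (hφ : φ ∈ Set.Icc 0 (π / 2)) : (u + φ) * |u - φ| / 50 ≤ |cos φ - cos u| := by
  obtain ⟨hu0, hu1⟩ := hu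
  obtain ⟨hφ0, hφ1⟩ := hφ
  have hp := pi_pos
  have h1 : (u + φ) / 2 / 5 ≤ |sin ((φ + u) / 2)| := by
    rw [add_comm φ u]
    exact (div_five_le_sin (by linarith) (by linarith)).trans (le_abs_self _)
  have h2 : |u - φ| / 2 / 5 ≤ |sin ((φ - u) / 2)| := by
    rcases le_total φ u with h | h
    · rw [abs_of_nonneg (by linarith), ← abs_neg, ← sin_neg,
        show -((φ - u) / 2) = (u - φ) / 2 by ring]
      exact (div_five_le_sin (by linarith) (by linarith)).trans (le_abs_self _)
    · rw [abs_of_nonpos (by linarith), show -(u - φ) / 2 = (φ - u) / 2 by ring]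
      exact (div_five_le_sin (by linarith) (by linarith)).trans (le_abs_self _)
  rw [cos_sub_cos, abs_mul, abs_mul, abs_neg, abs_two]
  have h3 := mul_le_mul h1 h2 (by positivity) (by positivity)
  linarith

lemma min_one_one_div_le {y z : ℝ} (hz : 0 ≤ z) (hzy : z ≤ y) :
    min 1 (1 / y) ≤ 2 * (1 + z)⁻¹ := by
  rw [← div_eq_mul_inv, le_div_iff₀ (by linarith)]
  rcases le_total z 1 with h | h
  · nlinarith [min_le_left 1 (1 / y)]
  · have hy : 0 < y := by linarith
    have h1 : min 1 (1 / y) ≤ 1 / y := min_le_right _ _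
    have h2 : 1 / y * (1 + z) ≤ 2 := by
      rw [div_mul_eq_mul_div, div_le_iff₀ hy]; linarith
    nlinarith

open Real in
lemma integral_inv_one_add_mul_abs {a : ℝ} (ha : 0 < a) :
    ∫ v in (0:ℝ)..π, (1 + a * |v|)⁻¹ = log (1 + a * π) / a := by
  have hp := pi_pos
  have h : ∫ v in (0:ℝ)..π, (1 + a * |v|)⁻¹ = ∫ v in (0:ℝ)..π, (1 + a * v)⁻¹ := by
    apply intervalIntegral.integral_congr
    intro v hv
    rw [Set.uIcc_of_le hp.le] at hv
    simp only [abs_of_nonneg hv.1]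
  rw [h, intervalIntegral.integral_comp_add_mul (fun x => x⁻¹) ha.ne', integral_inv_of_pos
    (by simp) (by positivity)]
  simp [div_eq_inv_mul]

open Real in
lemma integral_inv_one_add_mul_sq_le {b : ℝ} (hb : 0 < b) :
    ∫ v in (0:ℝ)..π, (1 + (b * v) ^ 2)⁻¹ ≤ 2 / b := by
  rw [intervalIntegral.integral_comp_mul_left (fun x => (1 + x ^ 2)⁻¹) hb.ne', integral_inv_one_add_sq]
  simp only [mul_zero, arctan_zero, sub_zero, smul_eq_mul]
  rw [← div_eq_inv_mul]
  gcongr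
  linarith [arctan_lt_pi_div_two (b * π), pi_le_four]

open Real MeasureTheory in
lemma intervalIntegrable_min_one_one_div (X c : ℝ) (hX : 0 < X) (a b : ℝ) :
    IntervalIntegrable (fun u => min 1 (1 / (X * |c - cos u|))) volume a b := by
  apply IntervalIntegrable.mono_fun' (g := fun _ => (1:ℝ)) (by simp)
  · apply Measurable.aestronglyMeasurable
    fun_prop
  · refine Filter.Eventually.of_forall fun u => ?_
    simp only
    rw [norm_of_nonneg (le_min zero_le_one (by positivity))]
    exact min_le_left _ _

open Real MeasureTheory in
lemma integral_min_sin_eq (X c : ℝ) (hX : 0 < X) :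
    ∫ ξ in (0:ℝ)..(2 * π), min 1 (1 / (X * |sin ξ + c|)) =
      2 * ∫ u in (0:ℝ)..π, min 1 (1 / (X * |c - cos u|)) := by
  set F : ℝ → ℝ := fun u => min 1 (1 / (X * |c - cos u|)) with hF
  have hi := intervalIntegrable_min_one_one_div X c hX
  have hper : Function.Periodic F (2 * π) := fun u => by simp [hF]
  have h1 : ∀ ξ, min 1 (1 / (X * |sin ξ + c|)) = F (ξ + π / 2) := fun ξ => by
    simp only [hF, cos_add_pi_div_two, sub_neg_eq_add, add_comm]
  simp only [h1]
  rw [intervalIntegral.integral_comp_add_right F (π / 2), zero_add, add_comm (2 * π),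
    hper.intervalIntegral_add_eq (π / 2) (-π), show -π + 2 * π = π by ring,
    ← intervalIntegral.integral_add_adjacent_intervals (hi (-π) 0) (hi 0 π)]
  have h := intervalIntegral.integral_comp_neg (a := 0) (b := π) F
  have h2 : ∀ u, F (-u) = F u := fun u => by simp [hF]
  simp only [h2, neg_zero] at h
  rw [← h]
  ring

open Real MeasureTheory in
/-- A continuous even kernel below the phase difference controls the integral over a half period. -/
lemma integral_min_cos_le {X φ : ℝ} (hX : 0 < X) (hφ : φ ∈ Set.Icc 0 (π / 2)) {g : ℝ → ℝ}
    (hg : Continuous g) (h0 : ∀ v, 0 ≤ g v) (heven : ∀ v, g (-v) = g v)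
    (hle : ∀ u ∈ Set.Icc 0 π, g (u - φ) ≤ X * |cos φ - cos u|) :
    ∫ u in (0:ℝ)..π, min 1 (1 / (X * |cos φ - cos u|)) ≤
      4 * ∫ v in (0:ℝ)..π, (1 + g v)⁻¹ := by
  have hp := pi_pos
  have hc : Continuous fun v => (1 + g v)⁻¹ :=
    (continuous_const.add hg).inv₀ fun v => (add_pos_of_pos_of_nonneg one_pos (h0 v)).ne'
  calc ∫ u in (0:ℝ)..π, min 1 (1 / (X * |cos φ - cos u|))
      ≤ ∫ u in (0:ℝ)..π, 2 * (1 + g (u - φ))⁻¹ := by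
        apply intervalIntegral.integral_mono_on hp.le
          (intervalIntegrable_min_one_one_div X _ hX _ _)
        · exact (continuous_const.mul
            (hc.comp (continuous_id.sub continuous_const))).intervalIntegrable _ _
        · exact fun u hu => min_one_one_div_le (h0 _) (hle u hu)
    _ = 2 * ∫ u in (0:ℝ)..π, (1 + g (u - φ))⁻¹ := by
        rw [intervalIntegral.integral_const_mul]
    _ ≤ 2 * (2 * ∫ v in (0:ℝ)..π, (1 + g v)⁻¹) := by
        gcongr
        exact integral_comp_sub_le_two_mul_of_even hc
          (fun v => inv_nonneg.2 (by linarith [h0 v])) (fun v => by rw [heven])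
          ⟨hφ.1, by linarith [hφ.2]⟩
    _ = _ := by ring

open Real in
lemma integral_min_cos_mul_sqrt_le {X φ : ℝ} (hX : 0 < X) (hφ : φ ∈ Set.Icc 0 (π / 2)) :
    (∫ u in (0:ℝ)..π, min 1 (1 / (X * |cos φ - cos u|))) * √X ≤ 64 := by
  have hs : 0 < √X := sqrt_pos.2 hX
  have hsq : √X ^ 2 = X := sq_sqrt hX.le
  have h := integral_min_cos_le hX hφ (g := fun v => (√X / 8 * v) ^ 2) (by fun_prop)
    (fun v => sq_nonneg _) (fun v => by ring) (fun u hu => by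
      have h1 := mul_abs_sub_le_abs_cos_sub_cos hu hφ
      have h2 : |u - φ| ≤ u + φ := abs_le.2 ⟨by linarith [hu.1], by linarith [hφ.1]⟩
      have h3 : (u - φ) ^ 2 ≤ (u + φ) * |u - φ| := by
        rw [← sq_abs, sq]; gcongr
      calc (√X / 8 * (u - φ)) ^ 2 = X * ((u - φ) ^ 2 / 64) := by
            rw [mul_pow, div_pow, hsq]; ring
        _ ≤ X * |cos φ - cos u| := by
            gcongr
            linarith [sq_nonneg (u - φ)])
  have h2 := integral_inv_one_add_mul_sq_le (b := √X / 8) (by positivity)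
  calc _ ≤ (4 * (2 / (√X / 8))) * √X := by gcongr; linarith
    _ = 64 := by field_simp; norm_num

open Real in
lemma integral_min_cos_mul_sin_le {X φ : ℝ} (hX : 0 < X) (hφ : φ ∈ Set.Icc 0 (π / 2)) :
    (∫ u in (0:ℝ)..π, min 1 (1 / (X * |cos φ - cos u|))) * (sin φ * X) ≤
      200 * (1 + |log X|) := by
  have hδ0 : 0 ≤ sin φ := sin_nonneg_of_nonneg_of_le_pi hφ.1 (by linarith [hφ.2, pi_pos])
  rcases hδ0.eq_or_lt with h0 | h0
  · rw [← h0]; simp; positivity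
  have ha : 0 < sin φ * X / 50 := by positivity
  have h := integral_min_cos_le hX hφ (g := fun v => sin φ * X / 50 * |v|) (by fun_prop)
    (fun v => by positivity) (fun v => by rw [abs_neg]) (fun u hu => by
      have h1 := mul_abs_sub_le_abs_cos_sub_cos hu hφ
      have h2 : sin φ ≤ u + φ := by linarith [sin_le hφ.1, hu.1]
      calc sin φ * X / 50 * |u - φ| = X * (sin φ * |u - φ| / 50) := by ring
        _ ≤ X * ((u + φ) * |u - φ| / 50) := by gcongr
        _ ≤ X * |cos φ - cos u| := by gcongr)
  rw [integral_inv_one_add_mul_abs ha] at h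
  have hlog : log (1 + sin φ * X / 50 * π) ≤ 1 + |log X| := by
    have hexp : 2 ≤ exp 1 := by linarith [add_one_le_exp (1:ℝ)]
    have hXe : X ≤ exp |log X| := by
      conv_lhs => rw [← exp_log hX]
      exact exp_le_exp.2 (le_abs_self _)
    have h1e : 1 ≤ exp |log X| := one_le_exp (abs_nonneg _)
    rw [log_le_iff_le_exp (by positivity), exp_add]
    have h3 : sin φ * X ≤ X := mul_le_of_le_one_left hX.le (sin_le_one φ)
    have h4 : sin φ * X / 50 * π ≤ X / 50 * 4 := by
      gcongr
      exact pi_le_four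
    nlinarith
  calc _ ≤ (4 * (log (1 + sin φ * X / 50 * π) / (sin φ * X / 50))) * (sin φ * X) := by gcongr
    _ = 200 * log (1 + sin φ * X / 50 * π) := by field_simp; ring
    _ ≤ _ := by gcongr

open Real in
lemma integral_min_cos_le_four {X c : ℝ} (hX : 0 < X) :
    ∫ u in (0:ℝ)..π, min 1 (1 / (X * |c - cos u|)) ≤ 4 := by
  calc _ ≤ ∫ _ in (0:ℝ)..π, (1:ℝ) :=
        intervalIntegral.integral_mono_on pi_pos.le
          (intervalIntegrable_min_one_one_div X _ hX _ _) (by simp) fun u _ => min_le_left _ _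
    _ ≤ 4 := by simpa using pi_le_four

theorem sin_oscillatory_measure_bound_small_alpha :
    ∃ K : ℝ, 0 < K ∧
      ∀ (X α : ℝ), 0 < X → α ∈ Set.Icc (0 : ℝ) 1 →
        (∫ ξ in (0:ℝ)..(2 * Real.pi), min 1 (1 / (X * |Real.sin ξ + α|))) ≤
          K * (1 + |Real.log X|) /
            (1 + X ^ ((1:ℝ)/2) + (1 - α ^ 2) ^ ((1:ℝ)/2) * X) := by
  refine ⟨600, by norm_num, fun X α hX hα => ?_⟩
  have hφ : Real.arccos α ∈ Set.Icc 0 (Real.pi / 2) :=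
    ⟨Real.arccos_nonneg α, Real.arccos_le_pi_div_two.2 hα.1⟩
  have hcos : Real.cos (Real.arccos α) = α := Real.cos_arccos (by linarith [hα.1]) hα.2
  have h1 := integral_min_cos_le_four (c := α) hX
  have h2 := integral_min_cos_mul_sqrt_le hX hφ
  have h3 := integral_min_cos_mul_sin_le hX hφ
  rw [hcos] at h2 h3
  rw [Real.sin_arccos] at h3
  rw [← Real.sqrt_eq_rpow, ← Real.sqrt_eq_rpow, integral_min_sin_eq X α hX,
    le_div_iff₀ (by positivity)]
  linarith [abs_nonneg (Real.log X)]
end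

section
/- There exists an absolute constant K > 0 such that for all X > 0 and all real α ≥ 1, ∫_0^{2π} min{ 1, 1/(X·|sin ξ + α|) } dξ ≤ K·(1 + |log X|) / ( 1 + X^{1/2} + (α²−1)^{1/2}·X ). -/
/-- For `β > 1` the reciprocal of `β + sin` has integral `2π / √(β² - 1)` over a period. -/
lemma integral_inv_add_sin {β s : ℝ} (hβ : 1 < β) (hs : 0 < s) (h : β ^ 2 = 1 + s ^ 2) :
    ∫ ξ in (0:ℝ)..(2 * Real.pi), (β + Real.sin ξ)⁻¹ = 2 * Real.pi / s := by
  have hpos : ∀ x, 0 < β + Real.sin x := fun x => by linarith [Real.neg_one_le_sin x]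
  have hcont : Continuous fun ξ => (β + Real.sin ξ)⁻¹ :=
    (continuous_const.add Real.continuous_sin).inv₀ fun x => (hpos x).ne'
  have hderiv : ∀ x, HasDerivAt
      (fun y => (y + 2 * Real.arctan (Real.cos y / (β + s + Real.sin y))) / s)
      ((β + Real.sin x)⁻¹) x := by
    intro x
    have hx := hpos x
    have hD : 0 < β + s + Real.sin x := by linarith
    have hd := ((hasDerivAt_id x).add (((Real.hasDerivAt_cos x).div
      ((Real.hasDerivAt_sin x).const_add (β + s)) hD.ne').arctan.const_mul 2)).div_const s
    refine hd.congr_deriv ?_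
    have hsc := Real.sin_sq_add_cos_sq x
    set S := Real.sin x
    set C := Real.cos x
    have hC : C ^ 2 = 1 - S ^ 2 := by linarith
    have hb : 0 < β + s := by linarith
    have hN : (β + s + S) ^ 2 + C ^ 2 = 2 * (β + s) * (β + S) := by
      rw [hC]; linear_combination -h
    have hinv : 1 / (1 + (C / (β + s + S)) ^ 2) =
        (β + s + S) ^ 2 / (2 * (β + s) * (β + S)) := by
      rw [← hN]
      have : (β + s + S) ^ 2 + C ^ 2 ≠ 0 := by positivity
      field_simp
    simp only [Pi.div_apply]
    rw [hinv]
    field_simp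
    linear_combination h - hC
  rw [intervalIntegral.integral_eq_sub_of_hasDerivAt (fun x _ => hderiv x)
    (hcont.intervalIntegrable _ _)]
  simp
  ring

lemma min_one_one_div_le_s8 {y : ℝ} (hy : 0 ≤ y) : min 1 (1 / y) ≤ 2 / (1 + y) := by
  rcases le_total y 1 with h | h
  · exact (min_le_left _ _).trans (by rw [le_div_iff₀ (by linarith)]; linarith)
  · exact (min_le_right _ _).trans
      (by rw [div_le_div_iff₀ (by linarith) (by linarith)]; linarith)

theorem sin_oscillatory_measure_bound_large_alpha :
    ∃ K : ℝ, 0 < K ∧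
      ∀ (X α : ℝ), 0 < X → 1 ≤ α →
        (∫ ξ in (0:ℝ)..(2 * Real.pi), min 1 (1 / (X * |Real.sin ξ + α|))) ≤
          K * (1 + |Real.log X|) /
            (1 + X ^ ((1:ℝ)/2) + (α ^ 2 - 1) ^ ((1:ℝ)/2) * X) := by
  have hπ := Real.pi_pos
  refine ⟨8 * Real.pi, by positivity, fun X α hX hα => ?_⟩
  rw [← Real.sqrt_eq_rpow, ← Real.sqrt_eq_rpow]
  have hα2 : 0 ≤ α ^ 2 - 1 := by nlinarith
  have hX' : 0 < 1 / X := by positivity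
  have hβ : 1 < α + 1 / X := by linarith
  set s := √((α + 1 / X) ^ 2 - 1)
  have hs0 : 0 < (α + 1 / X) ^ 2 - 1 := by nlinarith
  have hs : 0 < s := Real.sqrt_pos.2 hs0
  have hs2 : s ^ 2 = (α + 1 / X) ^ 2 - 1 := Real.sq_sqrt hs0.le
  have hval := integral_inv_add_sin hβ hs (by rw [hs2]; ring)
  have hnn : ∀ ξ, 0 ≤ Real.sin ξ + α := fun ξ => by linarith [Real.neg_one_le_sin ξ]
  have hI : (∫ ξ in (0:ℝ)..(2 * Real.pi), min 1 (1 / (X * |Real.sin ξ + α|))) ≤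
      ∫ ξ in (0:ℝ)..(2 * Real.pi), 2 / X * (α + 1 / X + Real.sin ξ)⁻¹ := by
    rw [intervalIntegral.integral_of_le (by positivity),
      intervalIntegral.integral_of_le (by positivity)]
    refine MeasureTheory.integral_mono_of_nonneg (.of_forall fun ξ => ?_) ?_
      (.of_forall fun ξ => ?_)
    · exact le_min zero_le_one (by positivity)
    · refine (Continuous.integrableOn_Ioc ?_)
      have hne : ∀ x, α + 1 / X + Real.sin x ≠ 0 := fun x =>
        ne_of_gt (by linarith [Real.neg_one_le_sin x])
      fun_prop (disch := exact hne _)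
    · have h0 := hnn ξ
      simp only [abs_of_nonneg h0]
      refine (min_one_one_div_le_s8 (mul_nonneg hX.le h0)).trans_eq ?_
      have h1 : 0 < 1 + X * (Real.sin ξ + α) := by positivity
      have h2 : α + 1 / X + Real.sin ξ = (1 + X * (Real.sin ξ + α)) / X := by
        field_simp; ring
      rw [h2]
      field_simp
  rw [intervalIntegral.integral_const_mul, hval] at hI
  have hD : 1 + √X + √(α ^ 2 - 1) * X ≤ 2 * (X * s) := by
    refine le_of_sq_le_sq ?_ (by positivity)
    have e1 := Real.sq_sqrt hX.le
    have e2 := Real.sq_sqrt hα2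
    have e3 : (X * s) ^ 2 = 1 + 2 * α * X + (√(α ^ 2 - 1) * X) ^ 2 := by
      rw [mul_pow, hs2, mul_pow, e2]; field_simp; ring
    rw [mul_pow, e3]
    nlinarith [sq_nonneg (1 - √X), sq_nonneg (1 - √(α ^ 2 - 1) * X),
      sq_nonneg (√X - √(α ^ 2 - 1) * X), mul_le_mul_of_nonneg_right hα hX.le]
  refine hI.trans ?_
  have hD0 : 0 < 1 + √X + √(α ^ 2 - 1) * X := by positivity
  calc 2 / X * (2 * Real.pi / s) = 8 * Real.pi / (2 * (X * s)) := by field_simp; ring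
    _ ≤ 8 * Real.pi / (1 + √X + √(α ^ 2 - 1) * X) := by gcongr
    _ ≤ _ := by
      refine div_le_div_of_nonneg_right ?_ hD0.le
      exact le_mul_of_one_le_right (by positivity) (by linarith [abs_nonneg (Real.log X)])
end

section
/- There exists an absolute constant K > 0 such that for all X > 0 and all a ∈ [0,1], ∫_0^∞ min{ 1, 1/(X·|cosh ξ − a|) } dξ ≤ K·(1 + |log X|) / ( 1 + X^{1/2} + (1−a²)^{1/2}·X ). -/
/-- A function on `(0, ∞)` bounded by `M` up to `T` and by `A / x ^ 2` beyond `T` has integral at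
most `M * T + A / T`. -/
theorem integral_Ioi_le_of_le_const_of_le_div_sq {f : ℝ → ℝ} {M T A : ℝ} (hT : 0 < T)
    (hf : ∀ x, 0 < x → 0 ≤ f x) (hM : ∀ x, 0 < x → x ≤ T → f x ≤ M)
    (hA : ∀ x, T < x → f x ≤ A / x ^ 2) :
    ∫ x in Set.Ioi (0 : ℝ), f x ≤ M * T + A / T := by
  set g : ℝ → ℝ := fun x => if x ≤ T then M else A * x ^ (-2 : ℝ)
  have hg₁ : Set.EqOn g (fun _ => M) (Set.Ioc 0 T) := fun x hx => if_pos hx.2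
  have hg₂ : Set.EqOn g (fun x => A * x ^ (-2 : ℝ)) (Set.Ioi T) :=
    fun x hx => if_neg (not_le.mpr hx)
  have hi₁ : MeasureTheory.IntegrableOn g (Set.Ioc 0 T) :=
    MeasureTheory.IntegrableOn.congr_fun (by simp) hg₁.symm measurableSet_Ioc
  have hi₂ : MeasureTheory.IntegrableOn g (Set.Ioi T) :=
    MeasureTheory.IntegrableOn.congr_fun
      ((integrableOn_Ioi_rpow_of_lt (by norm_num) hT).const_mul A) hg₂.symm measurableSet_Ioi
  have hu : Set.Ioc 0 T ∪ Set.Ioi T = Set.Ioi 0 := Set.Ioc_union_Ioi_eq_Ioi hT.le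
  have hg : ∫ x in Set.Ioi (0 : ℝ), g x = M * T + A / T := by
    rw [← hu, MeasureTheory.setIntegral_union (Set.Ioc_disjoint_Ioi le_rfl) measurableSet_Ioi
      hi₁ hi₂, MeasureTheory.setIntegral_congr_fun measurableSet_Ioc hg₁,
      MeasureTheory.setIntegral_congr_fun measurableSet_Ioi hg₂,
      MeasureTheory.integral_const_mul, integral_Ioi_rpow_of_lt (by norm_num) hT]
    have : (-2 : ℝ) + 1 = -1 := by norm_num
    simp [this, Real.rpow_neg_one, hT.le, div_eq_mul_inv, mul_comm]
  rw [← hg]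
  refine MeasureTheory.integral_mono_of_nonneg ?_ (hu ▸ hi₁.union hi₂) ?_
  · filter_upwards [MeasureTheory.ae_restrict_mem measurableSet_Ioi] with x hx using hf x hx
  · filter_upwards [MeasureTheory.ae_restrict_mem measurableSet_Ioi] with x hx
    rcases le_or_gt x T with h | h
    · rw [hg₁ ⟨hx, h⟩]
      exact hM x hx h
    · rw [hg₂ h]
      have hx' : (0 : ℝ) < x := hx
      beta_reduce
      rw [Real.rpow_neg hx'.le, Real.rpow_two, ← div_eq_mul_inv]
      exact hA x h

theorem min_one_div_mul_abs_le {X c y : ℝ} (hc : 0 ≤ c) (hy : 0 < y) (h : 1 ≤ y * (X * c)) :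
    min 1 (1 / (X * |c|)) ≤ y := by
  rw [abs_of_nonneg hc]
  refine (min_le_right _ _).trans ?_
  have : 0 < X * c := pos_of_mul_pos_right (by linarith) hy.le
  rwa [div_le_iff₀ this]

theorem one_add_sq_div_two_le_cosh (x : ℝ) : 1 + x ^ 2 / 2 ≤ Real.cosh x := by
  have h := Real.cosh_sq' (x / 2)
  have h2 : Real.cosh x = Real.cosh (x / 2) ^ 2 + Real.sinh (x / 2) ^ 2 := by
    rw [← Real.cosh_two_mul]
    ring_nf
  have h3 : (x / 2) ^ 2 ≤ Real.sinh (x / 2) ^ 2 := by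
    rw [sq_le_sq, Real.abs_sinh]
    exact Real.self_le_sinh_iff.mpr (abs_nonneg _)
  linarith

/-- A logarithmic bound, sharp for small `X`: the integrand decays exponentially past `|log X|`. -/
theorem integral_min_cosh_le_log {X a : ℝ} (hX : 0 < X) (ha : a ≤ 1) :
    ∫ ξ in Set.Ioi (0 : ℝ), min 1 (1 / (X * |Real.cosh ξ - a|)) ≤ 18 + 2 * |Real.log X| := by
  set L := |Real.log X|
  have hL : 0 ≤ L := abs_nonneg _
  have hT : 0 < 2 + 2 * L := by linarith
  have key := integral_Ioi_le_of_le_const_of_le_div_sq (M := 1) (A := 32)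
    (f := fun ξ => min 1 (1 / (X * |Real.cosh ξ - a|))) hT
    (fun ξ _ => by positivity) (fun ξ _ _ => min_le_left _ _) ?_
  · have : 32 / (2 + 2 * L) ≤ 16 := by
      rw [div_le_iff₀ hT]
      linarith
    linarith
  · intro ξ hξ
    have hξ0 : 0 < ξ := hT.trans hξ
    have hc := one_add_sq_div_two_le_cosh ξ
    refine min_one_div_mul_abs_le (by nlinarith) (by positivity) ?_
    have h4 : 4 ≤ Real.exp ξ := by
      have := Real.quadratic_le_exp_of_nonneg hξ0.le
      nlinarith
    have hcosh : Real.exp ξ / 4 ≤ Real.cosh ξ - a := by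
      rw [Real.cosh_eq]
      have := Real.exp_pos (-ξ)
      linarith
    have hXe : (ξ / 2) ^ 2 / 2 ≤ X * Real.exp ξ := by
      have h1 : X * Real.exp ξ = Real.exp (Real.log X + ξ) := by
        rw [Real.exp_add, Real.exp_log hX]
      have h2 : ξ / 2 ≤ Real.log X + ξ := by
        have := neg_abs_le (Real.log X)
        linarith
      have h3 := Real.quadratic_le_exp_of_nonneg (x := ξ / 2) (by linarith)
      rw [h1]
      refine le_trans ?_ (Real.exp_le_exp.mpr h2)
      linarith
    have hfin : ξ ^ 2 / 32 ≤ X * (Real.cosh ξ - a) := by nlinarith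
    rw [div_mul_eq_mul_div, le_div_iff₀ (by positivity)]
    linarith

theorem integral_min_cosh_mul_sqrt_le {X a : ℝ} (hX : 0 < X) (ha : a ≤ 1) :
    (∫ ξ in Set.Ioi (0 : ℝ), min 1 (1 / (X * |Real.cosh ξ - a|))) * √X ≤ 3 := by
  have hr : 0 < √X := Real.sqrt_pos.mpr hX
  have key := integral_Ioi_le_of_le_const_of_le_div_sq (M := 1) (A := 2 / X) (T := (√X)⁻¹)
    (f := fun ξ => min 1 (1 / (X * |Real.cosh ξ - a|))) (by positivity)
    (fun ξ _ => by positivity) (fun ξ _ _ => min_le_left _ _) ?_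
  · calc _ ≤ (1 * (√X)⁻¹ + 2 / X / (√X)⁻¹) * √X := by gcongr
      _ = 1 + 2 * (√X ^ 2 / X) := by field_simp
      _ = 3 := by rw [Real.sq_sqrt hX.le, div_self hX.ne']; norm_num
  · intro ξ hξ
    have hξ0 : 0 < ξ := lt_trans (by positivity) hξ
    have hc := one_add_sq_div_two_le_cosh ξ
    refine min_one_div_mul_abs_le (by nlinarith) (by positivity) ?_
    have : 2 / X / ξ ^ 2 * (X * (Real.cosh ξ - a)) = (Real.cosh ξ - a) / (ξ ^ 2 / 2) := by
      field_simp
    rw [this, le_div_iff₀ (by positivity)]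
    linarith

theorem integral_min_cosh_mul_sqrt_one_sub_le {X a : ℝ} (hX : 0 < X) (ha : a ≤ 1) :
    (∫ ξ in Set.Ioi (0 : ℝ), min 1 (1 / (X * |Real.cosh ξ - a|))) * (√(1 - a) * X) ≤ 3 := by
  rcases ha.eq_or_lt with rfl | ha
  · simp
  have hb : 0 < 1 - a := by linarith
  have hr : 0 < √(1 - a) := Real.sqrt_pos.mpr hb
  have key := integral_Ioi_le_of_le_const_of_le_div_sq (M := 1 / (X * (1 - a))) (A := 2 / X)
    (T := √(1 - a)) (f := fun ξ => min 1 (1 / (X * |Real.cosh ξ - a|))) hr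
    (fun ξ _ => by positivity) ?_ ?_
  · calc _ ≤ (1 / (X * (1 - a)) * √(1 - a) + 2 / X / √(1 - a)) * (√(1 - a) * X) := by gcongr
      _ = √(1 - a) ^ 2 / (1 - a) + 2 := by field_simp
      _ = 3 := by rw [Real.sq_sqrt hb.le, div_self hb.ne']; norm_num
  · intro ξ _ _
    have hc := Real.one_le_cosh ξ
    refine min_one_div_mul_abs_le (by linarith) (by positivity) ?_
    have : 1 / (X * (1 - a)) * (X * (Real.cosh ξ - a)) = (Real.cosh ξ - a) / (1 - a) := by
      field_simp
    rw [this, le_div_iff₀ hb]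
    linarith
  · intro ξ hξ
    have hξ0 : 0 < ξ := hr.trans hξ
    have hc := one_add_sq_div_two_le_cosh ξ
    refine min_one_div_mul_abs_le (by nlinarith) (by positivity) ?_
    have : 2 / X / ξ ^ 2 * (X * (Real.cosh ξ - a)) = (Real.cosh ξ - a) / (ξ ^ 2 / 2) := by
      field_simp
    rw [this, le_div_iff₀ (by positivity)]
    linarith

theorem cosh_measure_bound_small_alpha :
    ∃ K : ℝ, 0 < K ∧
      ∀ (X a : ℝ), 0 < X → a ∈ Set.Icc (0 : ℝ) 1 →
        (∫ ξ in Set.Ioi (0:ℝ), min 1 (1 / (X * |Real.cosh ξ - a|))) ≤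
          K * (1 + |Real.log X|) /
            (1 + X ^ ((1:ℝ)/2) + (1 - a ^ 2) ^ ((1:ℝ)/2) * X) := by
  refine ⟨54, by norm_num, fun X a hX ⟨ha0, ha1⟩ => ?_⟩
  rw [← Real.sqrt_eq_rpow, ← Real.sqrt_eq_rpow, le_div_iff₀ (by positivity)]
  have hI : 0 ≤ ∫ ξ in Set.Ioi (0 : ℝ), min 1 (1 / (X * |Real.cosh ξ - a|)) :=
    MeasureTheory.integral_nonneg fun ξ => by positivity
  have hlog := integral_min_cosh_le_log hX ha1
  have hX2 := integral_min_cosh_mul_sqrt_le hX ha1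
  have hb2 := integral_min_cosh_mul_sqrt_one_sub_le hX ha1
  set I := ∫ ξ in Set.Ioi (0 : ℝ), min 1 (1 / (X * |Real.cosh ξ - a|))
  have hL : 0 ≤ |Real.log X| := abs_nonneg _
  rcases le_total X 1 with h | h
  · have h1 : √X ≤ 1 := Real.sqrt_le_one.mpr h
    have h2 : √(1 - a ^ 2) ≤ 1 := Real.sqrt_le_one.mpr (by nlinarith)
    have h3 : √(1 - a ^ 2) * X ≤ 1 := mul_le_one₀ h2 hX.le h
    calc I * (1 + √X + √(1 - a ^ 2) * X) ≤ I * 3 := by gcongr; linarith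
      _ ≤ 54 * (1 + |Real.log X|) := by linarith
  · have h1 : 1 ≤ √X := Real.one_le_sqrt.mpr h
    have h2 : √(1 - a ^ 2) ≤ 2 * √(1 - a) := by
      rw [Real.sqrt_le_left (by positivity), mul_pow, Real.sq_sqrt (by linarith)]
      nlinarith
    calc I * (1 + √X + √(1 - a ^ 2) * X) ≤ I * (√X + √X + 2 * √(1 - a) * X) := by gcongr
      _ = 2 * (I * √X) + 2 * (I * (√(1 - a) * X)) := by ring
      _ ≤ 54 * (1 + |Real.log X|) := by linarith
end

section
/- For every ε > 0 and every δ ∈ (0, 1/4) there exists a constant K (depending only on ε and δ) such that for all t ∈ [0, 1/4 − δ], all x ∈ (0, 1], and all R ≥ 1: |∫_1^R cos(x·y)·(y²−1)^{−2t−1/2} dy| ≤ K·x^{−ε}. -/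
/-- Second-mean-value-type bound: if `f` is nonnegative with nonpositive derivative on `[a, b]`,
then `∫ cos (x y) f y` is at most `2 f a / x`. -/
theorem abs_integral_cos_mul_le_of_deriv_nonpos {f f' : ℝ → ℝ} {a b x : ℝ} (hab : a ≤ b)
    (hx : 0 < x) (hf : ∀ y ∈ Set.Icc a b, HasDerivAt f (f' y) y)
    (hf'c : ContinuousOn f' (Set.Icc a b)) (hf' : ∀ y ∈ Set.Icc a b, f' y ≤ 0)
    (hf0 : 0 ≤ f b) :
    |∫ y in a..b, Real.cos (x * y) * f y| ≤ 2 * f a / x := by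
  have hu : Set.uIcc a b = Set.Icc a b := Set.uIcc_of_le hab
  have hint : IntervalIntegrable f' MeasureTheory.volume a b :=
    ContinuousOn.intervalIntegrable (by rwa [hu])
  have hsin : ∀ y ∈ Set.uIcc a b,
      HasDerivAt (fun y => Real.sin (x * y) / x) (Real.cos (x * y)) y := by
    intro y _
    have h := (((hasDerivAt_id y).const_mul x).sin).div_const x
    simpa [hx.ne'] using h
  have hparts := intervalIntegral.integral_mul_deriv_eq_deriv_mul
    (u := f) (u' := f') (by rwa [hu]) hsin hint
    (Continuous.intervalIntegrable (by fun_prop) a b)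
  have hftc : ∫ y in a..b, f' y = f b - f a :=
    intervalIntegral.integral_eq_sub_of_hasDerivAt (by rwa [hu]) hint
  have hs : ∀ y, |Real.sin (x * y) / x| ≤ 1 / x := by
    intro y
    rw [abs_div, abs_of_pos hx]
    gcongr
    exact Real.abs_sin_le_one _
  have hrest : ‖∫ y in a..b, f' y * (Real.sin (x * y) / x)‖ ≤ ∫ y in a..b, -f' y * (1 / x) := by
    refine intervalIntegral.norm_integral_le_of_norm_le hab ?_ (hint.neg.mul_const _)
    filter_upwards with y hy
    have hy' := hf' y ⟨hy.1.le, hy.2⟩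
    rw [Real.norm_eq_abs, abs_mul, abs_of_nonpos hy']
    exact mul_le_mul_of_nonneg_left (hs y) (by linarith)
  rw [intervalIntegral.integral_mul_const, intervalIntegral.integral_neg, hftc,
    Real.norm_eq_abs] at hrest
  have hfa : 0 ≤ f a := by
    have h : ∫ y in a..b, f' y ≤ 0 := by
      have := intervalIntegral.integral_nonneg (f := fun y => -f' y) (μ := MeasureTheory.volume)
        hab (fun y hy => by linarith [hf' y hy])
      rw [intervalIntegral.integral_neg] at this
      linarith
    linarith
  have hcomm : ∫ y in a..b, Real.cos (x * y) * f y = ∫ y in a..b, f y * Real.cos (x * y) := by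
    simp only [mul_comm]
  have hb : |f b * (Real.sin (x * b) / x)| ≤ f b * (1 / x) := by
    rw [abs_mul, abs_of_nonneg hf0]
    exact mul_le_mul_of_nonneg_left (hs b) hf0
  have ha : |f a * (Real.sin (x * a) / x)| ≤ f a * (1 / x) := by
    rw [abs_mul, abs_of_nonneg hfa]
    exact mul_le_mul_of_nonneg_left (hs a) hfa
  rw [hcomm, hparts]
  calc _ ≤ f b * (1 / x) + f a * (1 / x) + -(f b - f a) * (1 / x) :=
        (abs_sub _ _).trans (add_le_add ((abs_sub _ _).trans (add_le_add hb ha)) hrest)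
    _ = 2 * f a / x := by ring

/-- A pure power of `y - 1` dominates `(y² - 1) ^ s` both near `1` and at infinity. -/
theorem sq_sub_one_rpow_le {s η y : ℝ} (hs : s ≤ -(1 / 2)) (hη : 0 ≤ η) (hηs : η - 1 ≤ s)
    (hy : 1 < y) : (y ^ 2 - 1) ^ s ≤ (y - 1) ^ (η - 1) := by
  have hu : 0 < y - 1 := by linarith
  rcases le_total (y - 1) 1 with h | h
  · calc (y ^ 2 - 1) ^ s ≤ (y - 1) ^ s :=
          Real.rpow_le_rpow_of_nonpos hu (by nlinarith) (by linarith)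
      _ ≤ (y - 1) ^ (η - 1) := Real.rpow_le_rpow_of_exponent_ge hu h hηs
  · calc (y ^ 2 - 1) ^ s ≤ ((y - 1) ^ (2 : ℕ)) ^ s :=
          Real.rpow_le_rpow_of_nonpos (by positivity) (by nlinarith) (by linarith)
      _ = (y - 1) ^ (2 * s) := by
          rw [← Real.rpow_natCast, ← Real.rpow_mul hu.le]
          norm_num
      _ ≤ (y - 1) ^ (η - 1) := Real.rpow_le_rpow_of_exponent_le h (by linarith)

theorem abs_cos_mul_sq_sub_one_rpow_le {s η x y : ℝ} (hs : s ≤ -(1 / 2)) (hη : 0 ≤ η)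
    (hηs : η - 1 ≤ s) (hy : 1 < y) :
    |Real.cos (x * y) * (y ^ 2 - 1) ^ s| ≤ (y - 1) ^ (η - 1) := by
  have h0 : 0 ≤ (y ^ 2 - 1) ^ s := Real.rpow_nonneg (by nlinarith) _
  rw [abs_mul, abs_of_nonneg h0]
  exact (mul_le_of_le_one_left h0 (Real.abs_cos_le_one _)).trans (sq_sub_one_rpow_le hs hη hηs hy)

theorem intervalIntegrable_sub_one_rpow {η : ℝ} (hη : 0 < η) (S : ℝ) :
    IntervalIntegrable (fun y : ℝ => (y - 1) ^ (η - 1)) MeasureTheory.volume 1 S := by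
  have h := (intervalIntegral.intervalIntegrable_rpow' (a := 0) (b := S - 1)
    (r := η - 1) (by linarith)).comp_sub_right 1
  simpa using h

theorem intervalIntegrable_cos_mul_sq_sub_one_rpow {s η x S : ℝ} (hs : s ≤ -(1 / 2))
    (hη : 0 < η) (hηs : η - 1 ≤ s) (hS : 1 ≤ S) :
    IntervalIntegrable (fun y : ℝ => Real.cos (x * y) * (y ^ 2 - 1) ^ s)
      MeasureTheory.volume 1 S := by
  refine (intervalIntegrable_sub_one_rpow hη S).mono_fun' ?_ ?_
  · exact Measurable.aestronglyMeasurable (by fun_prop)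
  · rw [Set.uIoc_of_le hS]
    refine (MeasureTheory.ae_restrict_iff' measurableSet_Ioc).2 (Filter.Eventually.of_forall ?_)
    intro y hy
    exact abs_cos_mul_sq_sub_one_rpow_le hs hη.le hηs hy.1

theorem abs_integral_cos_mul_sq_sub_one_rpow_le {s η x S : ℝ} (hs : s ≤ -(1 / 2)) (hη : 0 < η)
    (hηs : η - 1 ≤ s) (hS : 1 ≤ S) :
    |∫ y in (1 : ℝ)..S, Real.cos (x * y) * (y ^ 2 - 1) ^ s| ≤ (S - 1) ^ η / η := by
  have h := intervalIntegral.norm_integral_le_of_norm_le (μ := MeasureTheory.volume)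
    (f := fun y : ℝ => Real.cos (x * y) * (y ^ 2 - 1) ^ s) hS
    (Filter.Eventually.of_forall fun y hy =>
      abs_cos_mul_sq_sub_one_rpow_le hs hη.le hηs hy.1)
    (intervalIntegrable_sub_one_rpow hη S)
  rw [intervalIntegral.integral_comp_sub_right (fun y : ℝ => y ^ (η - 1)),
    integral_rpow (Or.inl (by linarith))] at h
  simpa [Real.zero_rpow hη.ne'] using h

theorem abs_integral_cos_mul_sq_sub_one_rpow_tail_le {s η x M R : ℝ} (hs : s ≤ -(1 / 2))
    (hη : 0 ≤ η) (hηs : η - 1 ≤ s) (hx : 0 < x) (hM : 1 < M) (hMR : M ≤ R) :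
    |∫ y in M..R, Real.cos (x * y) * (y ^ 2 - 1) ^ s| ≤ 2 * (M - 1) ^ (η - 1) / x := by
  have hpos : ∀ y, M ≤ y → 0 < y ^ 2 - 1 := fun y hy => by nlinarith
  refine (abs_integral_cos_mul_le_of_deriv_nonpos (f := fun y : ℝ => (y ^ 2 - 1) ^ s)
    (f' := fun y : ℝ => 2 * y * s * (y ^ 2 - 1) ^ (s - 1)) hMR hx ?_ ?_ ?_ ?_).trans ?_
  · intro y hy
    have h := (((hasDerivAt_id y).pow 2).sub_const 1).rpow_const (p := s)
      (Or.inl (hpos y hy.1).ne')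
    simpa using h
  · refine ContinuousOn.mul (by fun_prop) (ContinuousOn.rpow_const (by fun_prop) ?_)
    exact fun y hy => Or.inl (hpos y hy.1).ne'
  · intro y hy
    have h1 := Real.rpow_nonneg (hpos y hy.1).le (s - 1)
    have h2 : 2 * y * s ≤ 0 :=
      mul_nonpos_of_nonneg_of_nonpos (by linarith [hy.1]) (by linarith)
    exact mul_nonpos_of_nonpos_of_nonneg h2 h1
  · exact Real.rpow_nonneg (hpos R hMR).le _
  · gcongr
    exact sq_sub_one_rpow_le hs hη hηs hM

theorem bessel_Y_integral_representation_bound :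
    ∀ ε : ℝ, 0 < ε → ∀ δ : ℝ, δ ∈ Set.Ioo (0 : ℝ) (1/4) →
      ∃ K : ℝ, 0 < K ∧
        ∀ (t x R : ℝ), t ∈ Set.Icc (0 : ℝ) (1/4 - δ) → x ∈ Set.Ioc (0 : ℝ) 1 → 1 ≤ R →
          |∫ y in (1:ℝ)..R, Real.cos (x * y) * (y ^ 2 - 1) ^ (-(2 * t) - 1/2 : ℝ)| ≤
            K * x ^ (-ε) := by
  rintro ε hε δ ⟨hδ, -⟩
  obtain ⟨η, hη, hηε, hηδ⟩ : ∃ η : ℝ, 0 < η ∧ η ≤ ε ∧ η ≤ 2 * δ :=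
    ⟨min ε (2 * δ), lt_min hε (by linarith), min_le_left _ _, min_le_right _ _⟩
  refine ⟨1 / η + 2, by positivity, ?_⟩
  rintro t x R ⟨ht0, ht1⟩ ⟨hx0, hx1⟩ hR
  have hs : -(2 * t) - 1/2 ≤ -(1 / 2) := by linarith
  have hηs : η - 1 ≤ -(2 * t) - 1/2 := by linarith
  generalize -(2 * t) - 1/2 = s at hs hηs ⊢
  have hxη : x ^ (-η) ≤ x ^ (-ε) := Real.rpow_le_rpow_of_exponent_ge hx0 hx1 (by linarith)
  have hxε : 0 ≤ x ^ (-ε) := Real.rpow_nonneg hx0.le _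
  have head : ∀ S, 1 ≤ S → S ≤ 1 + x⁻¹ →
      |∫ y in (1 : ℝ)..S, Real.cos (x * y) * (y ^ 2 - 1) ^ s| ≤ 1 / η * x ^ (-ε) := by
    intro S hS hSx
    calc _ ≤ (S - 1) ^ η / η := abs_integral_cos_mul_sq_sub_one_rpow_le hs hη hηs hS
      _ ≤ (x⁻¹) ^ η / η := by
          gcongr
          · linarith
      _ = 1 / η * x ^ (-η) := by
          rw [Real.inv_rpow hx0.le, Real.rpow_neg hx0.le]
          ring
      _ ≤ 1 / η * x ^ (-ε) := by gcongr
  rcases le_total R (1 + x⁻¹) with h | h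
  · linarith [head R hR h]
  have hxi : 0 < x⁻¹ := inv_pos.2 hx0
  have hM : 1 < 1 + x⁻¹ := by linarith
  have htail := abs_integral_cos_mul_sq_sub_one_rpow_tail_le hs hη.le hηs hx0 hM h
  have hpow : 2 * (1 + x⁻¹ - 1) ^ (η - 1) / x = 2 * x ^ (-η) := by
    rw [add_sub_cancel_left, Real.inv_rpow hx0.le, ← Real.rpow_neg hx0.le, mul_div_assoc,
      ← Real.rpow_sub_one hx0.ne']
    ring_nf
  rw [hpow] at htail
  have hI1 := intervalIntegrable_cos_mul_sq_sub_one_rpow (x := x) hs hη hηs hM.le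
  have hI2 := intervalIntegrable_cos_mul_sq_sub_one_rpow (x := x) hs hη hηs hR
  rw [← intervalIntegral.integral_add_adjacent_intervals hI1 (hI1.symm.trans hI2)]
  refine (abs_add_le _ _).trans ?_
  linarith [head _ hM.le le_rfl]
end

section
/- For every K₀ > 0 there exists a constant K > 0 such that the following holds. Let X > 0, let α ∈ [−1, 1], let k ≥ 0 be an integer, and let g : ℝ → [0,1] be a continuously differentiable function with support contained in [X/3, 2X] and ∫_ℝ |g'(x)| dx ≤ K₀. Define J_k(y) = (1/(2π)) ∫_0^{2π} cos( y·sin ξ − k·ξ ) dξ. Then |∫_0^∞ J_k(y)·e^{iαy}·g(y) · dy/y| ≤ K·(1 + |log X|) / ( 1 + X^{1/2} + (1−α²)^{1/2}·X ). -/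
/-- The Bessel function of the first kind of integer order `k`, via its integral
representation `J_k(y) = (1/2π) ∫_0^{2π} cos(y sin ξ − kξ) dξ`. -/
noncomputable def besselJ (k : ℕ) (y : ℝ) : ℝ :=
  (1 / (2 * Real.pi)) * ∫ ξ in (0:ℝ)..(2 * Real.pi), Real.cos (y * Real.sin ξ - k * ξ)

lemma sqrt_div_le_of_le {X p q : ℝ} (hX : 1 ≤ X) (hp : 0 ≤ p) (hpq : p ≤ q) :
    √X / (1 + X * (p * q)) ≤ 2 * (X / (1 + X * p)) := by
  have hr : 1 ≤ √X := Real.one_le_sqrt.mpr hX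
  obtain ⟨r, hr', rfl⟩ : ∃ r, 1 ≤ r ∧ X = r ^ 2 := ⟨√X, hr, (Real.sq_sqrt (by linarith)).symm⟩
  rw [Real.sqrt_sq (by linarith), ← mul_div_assoc]
  have h1 : p * p ≤ p * q := by gcongr
  have h2 : 0 ≤ p * q := by nlinarith
  rw [div_le_div_iff₀ (by positivity) (by positivity)]
  have h3 : r * (1 + r ^ 2 * p) ≤ 2 * r ^ 2 * (1 + r ^ 2 * (p * p)) := by
    nlinarith [mul_nonneg (sq_nonneg r) (sq_nonneg (r * p - 1)), mul_nonneg (sq_nonneg r) (sq_nonneg (r * p))]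
  have h4 : 2 * r ^ 2 * (1 + r ^ 2 * (p * p)) ≤ 2 * r ^ 2 * (1 + r ^ 2 * (p * q)) := by gcongr
  linarith

lemma mul_div_one_add_mul_le {X p q : ℝ} (hX : 0 ≤ X) (hp : 0 ≤ p) (hp1 : p ≤ 1) (hq : 0 ≤ q) :
    p * X / (1 + X * (p * q)) ≤ X / (1 + X * q) := by
  rw [div_le_div_iff₀ (by positivity) (by positivity)]
  nlinarith [mul_nonneg hX (sub_nonneg.mpr hp1)]

lemma weight_div_one_add_mul_le {X p q s : ℝ} (hX : 1 ≤ X) (hp : 0 ≤ p) (hp1 : p ≤ 1)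
    (hq : 0 ≤ q) (hq1 : q ≤ 1) (hs : s ≤ p + q) :
    (1 + √X + s * X) / (1 + X * (p * q)) ≤ 5 * (X / (1 + X * p) + X / (1 + X * q)) := by
  have hX0 : 0 ≤ X := by linarith
  have hr : 1 ≤ √X := Real.one_le_sqrt.mpr hX
  have hP : 0 ≤ X / (1 + X * p) := by positivity
  have hQ : 0 ≤ X / (1 + X * q) := by positivity
  have h1 := mul_div_one_add_mul_le hX0 hp hp1 hq
  have h2 := mul_div_one_add_mul_le hX0 hq hq1 hp
  rw [mul_comm q p] at h2
  have h3 : √X / (1 + X * (p * q)) ≤ 2 * (X / (1 + X * p) + X / (1 + X * q)) := by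
    rcases le_total p q with h | h
    · linarith [sqrt_div_le_of_le hX hp h]
    · have := sqrt_div_le_of_le hX hq h
      rw [mul_comm q p] at this
      linarith
  have h4 : (1 + √X + s * X) / (1 + X * (p * q)) ≤
      (2 * √X + (p * X + q * X)) / (1 + X * (p * q)) := by
    have h5 : s * X ≤ p * X + q * X := by nlinarith
    gcongr
    linarith
  refine h4.trans ?_
  rw [add_div, add_div, mul_div_assoc]
  linarith

lemma abs_sin_add_sin (a ξ : ℝ) : |Real.sin a + Real.sin ξ| =
    2 * (|Real.sin (ξ / 2 + a / 2)| * |Real.sin (ξ / 2 + (Real.pi / 2 - a / 2))|) := by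
  have h1 : Real.sin (ξ / 2 + (Real.pi / 2 - a / 2)) = Real.cos (ξ / 2 - a / 2) := by
    rw [← Real.sin_add_pi_div_two]; ring_nf
  have h2 : Real.sin a + Real.sin ξ =
      2 * (Real.sin (ξ / 2 + a / 2) * Real.cos (ξ / 2 - a / 2)) := by
    rw [add_comm, Real.sin_add_sin, add_div, sub_div, mul_assoc]
  rw [h1, h2, abs_mul, abs_mul, abs_two]

lemma cos_le_abs_sin_add_abs_sin (a ξ : ℝ) : Real.cos a ≤
    |Real.sin (ξ / 2 + a / 2)| + |Real.sin (ξ / 2 + (Real.pi / 2 - a / 2))| := by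
  have h1 : Real.sin (ξ / 2 + (Real.pi / 2 - a / 2)) = Real.cos (ξ / 2 - a / 2) := by
    rw [← Real.sin_add_pi_div_two]; ring_nf
  have e1 : Real.cos a = Real.cos ((ξ / 2 + a / 2) - (ξ / 2 - a / 2)) := by ring_nf
  rw [h1, e1, Real.cos_sub]
  set u := ξ / 2 + a / 2
  set v := ξ / 2 - a / 2
  have hu : Real.cos u * Real.cos v ≤ |Real.cos v| := by
    refine (le_abs_self _).trans ?_
    rw [abs_mul]
    exact mul_le_of_le_one_left (abs_nonneg _) (Real.abs_cos_le_one u)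
  have hv : Real.sin u * Real.sin v ≤ |Real.sin u| := by
    refine (le_abs_self _).trans ?_
    rw [abs_mul]
    exact mul_le_of_le_one_right (abs_nonneg _) (Real.abs_sin_le_one v)
  linarith

lemma integral_div_one_add_mul_linear {X : ℝ} (hX : 0 < X) :
    ∫ u in (0:ℝ)..Real.pi, X / (1 + X * (2 / Real.pi * u)) =
      Real.pi / 2 * Real.log (1 + 2 * X) := by
  have hpi := Real.pi_pos
  have h : ∀ u ∈ Set.uIcc 0 Real.pi,
      HasDerivAt (fun u => Real.pi / 2 * Real.log (1 + X * (2 / Real.pi * u)))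
        (X / (1 + X * (2 / Real.pi * u))) u := by
    intro u hu
    rw [Set.uIcc_of_le hpi.le] at hu
    have hu0 := hu.1
    have hpos : 0 < 1 + X * (2 / Real.pi * u) := by positivity
    refine (((((hasDerivAt_id' u).const_mul (2 / Real.pi)).const_mul X).const_add 1).log
      hpos.ne' |>.const_mul (Real.pi / 2)).congr_deriv ?_
    field_simp
  rw [intervalIntegral.integral_eq_sub_of_hasDerivAt h]
  · have : 1 + X * (2 / Real.pi * Real.pi) = 1 + 2 * X := by field_simp
    rw [this]
    simp
  · apply ContinuousOn.intervalIntegrable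
    intro u hu
    rw [Set.uIcc_of_le hpi.le] at hu
    have hu0 := hu.1
    have hpos : 0 < 1 + X * (2 / Real.pi * u) := by positivity
    apply ContinuousAt.continuousWithinAt
    fun_prop (disch := exact hpos.ne')

lemma continuous_div_one_add_mul_abs {X : ℝ} (hX : 0 ≤ X) {f : ℝ → ℝ} (hf : Continuous f) (c : ℝ) :
    Continuous fun u => c / (1 + X * |f u|) := by
  refine continuous_const.div (by fun_prop) fun u => ?_
  positivity

lemma integral_div_one_add_mul_abs_sin_le {X : ℝ} (hX : 0 < X) :
    ∫ u in (0:ℝ)..Real.pi, X / (1 + X * |Real.sin u|) ≤ Real.pi * Real.log (1 + 2 * X) := by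
  have hpi := Real.pi_pos
  set f : ℝ → ℝ := fun u => X / (1 + X * (2 / Real.pi * u)) with hf
  have hfi : IntervalIntegrable f MeasureTheory.volume 0 Real.pi := by
    apply ContinuousOn.intervalIntegrable
    intro u hu
    rw [Set.uIcc_of_le hpi.le] at hu
    have hu0 := hu.1
    have hpos : 0 < 1 + X * (2 / Real.pi * u) := by positivity
    apply ContinuousAt.continuousWithinAt
    fun_prop (disch := exact hpos.ne')
  have hfi' : IntervalIntegrable (fun u => f (Real.pi - u)) MeasureTheory.volume 0 Real.pi := by
    simpa using (hfi.comp_sub_left Real.pi).symm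
  have hrefl : ∫ u in (0:ℝ)..Real.pi, f (Real.pi - u) = ∫ u in (0:ℝ)..Real.pi, f u := by
    simp
  calc ∫ u in (0:ℝ)..Real.pi, X / (1 + X * |Real.sin u|)
      ≤ ∫ u in (0:ℝ)..Real.pi, (f u + f (Real.pi - u)) := by
        refine intervalIntegral.integral_mono_on hpi.le
          ((continuous_div_one_add_mul_abs hX.le Real.continuous_sin X).intervalIntegrable _ _)
          (hfi.add hfi') fun u hu => ?_
        have hu0 := hu.1
        have hu1 : 0 ≤ Real.pi - u := sub_nonneg.mpr hu.2
        have hf0 : 0 ≤ f u := by simp only [hf]; positivity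
        have hf1 : 0 ≤ f (Real.pi - u) := by simp only [hf]; positivity
        have key : ∀ v, 0 ≤ v → v ≤ Real.pi / 2 → X / (1 + X * |Real.sin v|) ≤ f v := by
          intro v hv hv'
          simp only [hf]
          gcongr
          exact (Real.mul_le_sin hv hv').trans (le_abs_self _)
        rcases le_total u (Real.pi / 2) with h | h
        · linarith [key u hu0 h]
        · have := key (Real.pi - u) hu1 (by linarith)
          rw [Real.sin_pi_sub] at this
          linarith
    _ = Real.pi * Real.log (1 + 2 * X) := by
        rw [intervalIntegral.integral_add hfi hfi', hrefl, hf, integral_div_one_add_mul_linear hX]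
        ring

lemma integral_div_one_add_mul_abs_sin_half_le {X : ℝ} (hX : 0 < X) (d : ℝ) :
    ∫ ξ in (0:ℝ)..(2 * Real.pi), X / (1 + X * |Real.sin (ξ / 2 + d)|) ≤
      2 * Real.pi * Real.log (1 + 2 * X) := by
  have hper : Function.Periodic (fun u => X / (1 + X * |Real.sin u|)) Real.pi := by
    intro u
    simp [Real.sin_add_pi]
  have h := intervalIntegral.integral_comp_div_add (a := 0) (b := 2 * Real.pi)
    (fun u => X / (1 + X * |Real.sin u|)) (two_ne_zero) d
  rw [h, show 0 / 2 + d = d by ring, show 2 * Real.pi / 2 + d = d + Real.pi by ring,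
    hper.intervalIntegral_add_eq d 0, zero_add, smul_eq_mul]
  linarith [integral_div_one_add_mul_abs_sin_le hX]

lemma weight_mul_integral_le_of_one_le {X : ℝ} (hX : 1 ≤ X) (a : ℝ) (ha : 0 ≤ Real.cos a) :
    (1 + √X + Real.cos a * X) *
      ∫ ξ in (0:ℝ)..(2 * Real.pi), 1 / (1 + X * |Real.sin a + Real.sin ξ|) ≤
      20 * Real.pi * Real.log (1 + 2 * X) := by
  have hX0 : 0 < X := by linarith
  have hpi := Real.pi_pos
  have hc : ∀ d : ℝ, IntervalIntegrable (fun ξ => X / (1 + X * |Real.sin (ξ / 2 + d)|))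
      MeasureTheory.volume 0 (2 * Real.pi) := fun d =>
    (continuous_div_one_add_mul_abs hX0.le (by fun_prop) X).intervalIntegrable _ _
  rw [← intervalIntegral.integral_const_mul]
  calc _ ≤ ∫ ξ in (0:ℝ)..(2 * Real.pi), 5 * (X / (1 + X * |Real.sin (ξ / 2 + a / 2)|) +
        X / (1 + X * |Real.sin (ξ / 2 + (Real.pi / 2 - a / 2))|)) := by
        refine intervalIntegral.integral_mono_on (by positivity)
          (((continuous_div_one_add_mul_abs hX0.le (by fun_prop) 1).const_mul
            _).intervalIntegrable _ _)
          (((hc _).add (hc _)).const_mul 5) fun ξ _ => ?_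
        refine le_trans ?_ (weight_div_one_add_mul_le hX (abs_nonneg _) (Real.abs_sin_le_one _)
          (abs_nonneg _) (Real.abs_sin_le_one _) (cos_le_abs_sin_add_abs_sin a ξ))
        rw [abs_sin_add_sin, mul_one_div]
        have h : ∀ p : ℝ, 0 ≤ p → p ≤ 2 * p := fun p hp => by linarith
        gcongr _ / (1 + X * ?_)
        exact h _ (by positivity)
    _ ≤ _ := by
        rw [intervalIntegral.integral_const_mul, intervalIntegral.integral_add (hc _) (hc _)]
        linarith [integral_div_one_add_mul_abs_sin_half_le hX0 (a / 2),
          integral_div_one_add_mul_abs_sin_half_le hX0 (Real.pi / 2 - a / 2)]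

lemma weight_mul_integral_le {X : ℝ} (hX : 0 < X) (a : ℝ) (ha : 0 ≤ Real.cos a) :
    (1 + √X + Real.cos a * X) *
      ∫ ξ in (0:ℝ)..(2 * Real.pi), 1 / (1 + X * |Real.sin a + Real.sin ξ|) ≤
      40 * Real.pi * (1 + |Real.log X|) := by
  have hpi := Real.pi_pos
  rcases le_total 1 X with h | h
  · refine (weight_mul_integral_le_of_one_le h a ha).trans ?_
    have h1 : Real.log (1 + 2 * X) ≤ Real.log (3 * X) :=
      Real.log_le_log (by positivity) (by linarith)
    rw [Real.log_mul (by norm_num) hX.ne'] at h1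
    have h2 : Real.log 3 ≤ 2 := by linarith [Real.log_le_sub_one_of_pos (x := 3) (by norm_num)]
    have h3 : Real.log (1 + 2 * X) ≤ 2 * (1 + |Real.log X|) := by
      linarith [le_abs_self (Real.log X), abs_nonneg (Real.log X)]
    nlinarith
  · have h1 : √X ≤ 1 := Real.sqrt_le_one.mpr h
    have h2 : Real.cos a * X ≤ 1 := by nlinarith [Real.cos_le_one a]
    have h3 : ∫ ξ in (0:ℝ)..(2 * Real.pi), 1 / (1 + X * |Real.sin a + Real.sin ξ|) ≤
        ∫ ξ in (0:ℝ)..(2 * Real.pi), (1 : ℝ) := by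
      refine intervalIntegral.integral_mono_on (by positivity)
        ((continuous_div_one_add_mul_abs hX.le (by fun_prop) 1).intervalIntegrable _ _)
        (by simp) fun ξ _ => ?_
      exact div_le_one_of_le₀ (by linarith [mul_nonneg hX.le (abs_nonneg (Real.sin a + Real.sin ξ))])
        (by positivity)
    rw [intervalIntegral.integral_const, smul_eq_mul] at h3
    have h4 : (1 + √X + Real.cos a * X) *
        ∫ ξ in (0:ℝ)..(2 * Real.pi), 1 / (1 + X * |Real.sin a + Real.sin ξ|) ≤
        3 * (2 * Real.pi) := by
      have : (1 + √X + Real.cos a * X) ≤ 3 := by linarith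
      have h0 : 0 ≤ (1 + √X + Real.cos a * X) := by positivity
      nlinarith
    nlinarith [mul_nonneg hpi.le (abs_nonneg (Real.log X))]

lemma eq_zero_of_support_subset_Icc_s17 {X : ℝ} {g : ℝ → ℝ}
    (hs : Function.support g ⊆ Set.Icc (X / 3) (2 * X)) {y : ℝ} (hy : y ∉ Set.Icc (X / 3) (2 * X)) :
    g y = 0 :=
  Function.notMem_support.mp fun h => hy (hs h)

lemma continuous_div_id_of_support_subset {X : ℝ} {g : ℝ → ℝ} (hX : 0 < X) (hg : Continuous g)
    (hs : Function.support g ⊆ Set.Icc (X / 3) (2 * X)) : Continuous fun y => g y / y := by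
  have h : (fun y => g y / y) = fun y => g y / max y (X / 3) := by
    funext y
    by_cases hy : y ∈ Set.Icc (X / 3) (2 * X)
    · rw [max_eq_left hy.1]
    · simp [eq_zero_of_support_subset_Icc_s17 hs hy]
  rw [h]
  exact hg.div (by fun_prop) fun y => (lt_max_of_lt_right (by positivity)).ne'

lemma norm_exp_I_mul_mul (t y : ℝ) : ‖Complex.exp (Complex.I * t * y)‖ = 1 := by
  rw [show Complex.I * t * y = ((t * y : ℝ) : ℂ) * Complex.I by push_cast; ring]
  exact Complex.norm_exp_ofReal_mul_I _

lemma hasDerivAt_exp_I_mul_mul (t y : ℝ) :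
    HasDerivAt (fun y : ℝ => Complex.exp (Complex.I * t * y))
      (Complex.I * t * Complex.exp (Complex.I * t * y)) y := by
  refine ((hasDerivAt_id' (y : ℂ)).const_mul (Complex.I * t)).cexp.comp_ofReal.congr_deriv ?_
  ring

lemma norm_integral_exp_mul_div_le {X : ℝ} {g : ℝ → ℝ} (hX : 0 < X)
    (h01 : ∀ x, g x ∈ Set.Icc (0 : ℝ) 1) (t : ℝ) :
    ‖∫ y in (X / 6)..(3 * X), Complex.exp (Complex.I * t * y) * (g y / y)‖ ≤ 18 := by
  have h := intervalIntegral.norm_integral_le_of_norm_le_const (a := X / 6) (b := 3 * X) (C := 6 / X)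
    (f := fun y : ℝ => Complex.exp (Complex.I * t * y) * (g y / y)) fun y hy => by
      rw [Set.uIoc_of_le (by linarith)] at hy
      have hy0 : 0 < y := by linarith [hy.1]
      rw [norm_mul, norm_exp_I_mul_mul, one_mul, ← Complex.ofReal_div, Complex.norm_real,
        Real.norm_of_nonneg (div_nonneg (h01 y).1 hy0.le), div_le_div_iff₀ hy0 hX]
      nlinarith [(h01 y).2, hy.1]
  refine h.trans ?_
  rw [abs_of_nonneg (by linarith), div_mul_eq_mul_div, div_le_iff₀ hX]
  linarith

lemma intervalIntegral_abs_deriv_le {X K₀ : ℝ} {g : ℝ → ℝ} (hX : 0 < X)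
    (hg : ContDiff ℝ 1 g) (hs : Function.support g ⊆ Set.Icc (X / 3) (2 * X))
    (hK : (∫ x : ℝ, |deriv g x|) ≤ K₀) :
    ∫ y in (X / 6)..(3 * X), |deriv g y| ≤ K₀ := by
  have hc : HasCompactSupport g := HasCompactSupport.of_support_subset_isCompact isCompact_Icc hs
  have hi : MeasureTheory.Integrable fun x => |deriv g x| :=
    ((hg.continuous_deriv le_rfl).integrable_of_hasCompactSupport hc.deriv).abs
  rw [intervalIntegral.integral_of_le (by linarith)]
  exact (MeasureTheory.setIntegral_le_integral hi
    (Filter.Eventually.of_forall fun x => abs_nonneg _)).trans hK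

lemma mul_norm_integral_exp_mul_div_le {X K₀ : ℝ} {g : ℝ → ℝ} (hX : 0 < X)
    (h01 : ∀ x, g x ∈ Set.Icc (0 : ℝ) 1) (hg : ContDiff ℝ 1 g)
    (hs : Function.support g ⊆ Set.Icc (X / 3) (2 * X))
    (hK : (∫ x : ℝ, |deriv g x|) ≤ K₀) (t : ℝ) :
    X * |t| * ‖∫ y in (X / 6)..(3 * X), Complex.exp (Complex.I * t * y) * (g y / y)‖ ≤
      6 * K₀ + 108 := by
  have hle : X / 6 ≤ 3 * X := by linarith
  have hpos : ∀ y ∈ Set.uIcc (X / 6) (3 * X), 0 < y := fun y hy => by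
    rw [Set.uIcc_of_le hle] at hy
    linarith [hy.1]
  have hg' := hg.continuous_deriv le_rfl
  have hcont := continuous_div_id_of_support_subset hX hg.continuous hs
  set e : ℝ → ℂ := fun y => Complex.exp (Complex.I * t * y) with he
  have hec : Continuous e := by fun_prop
  set h' : ℝ → ℝ := fun y => (deriv g y * y - g y * 1) / y ^ 2 with hh'
  have hh'c : ContinuousOn h' (Set.uIcc (X / 6) (3 * X)) := by
    refine ContinuousOn.div ?_ (by fun_prop) fun y hy => (pow_pos (hpos y hy) 2).ne'
    exact ((hg'.mul continuous_id).sub (hg.continuous.mul continuous_const)).continuousOn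
  have hi1 : IntervalIntegrable (fun y => Complex.I * t * (e y * ((g y / y : ℝ) : ℂ)))
      MeasureTheory.volume (X / 6) (3 * X) :=
    (continuous_const.mul (hec.mul (Complex.continuous_ofReal.comp hcont))).intervalIntegrable _ _
  have hi2 : IntervalIntegrable (fun y => e y * (h' y : ℂ))
      MeasureTheory.volume (X / 6) (3 * X) :=
    (hec.continuousOn.mul (Complex.continuous_ofReal.comp_continuousOn hh'c)).intervalIntegrable
  have hftc := intervalIntegral.integral_eq_sub_of_hasDerivAt (a := X / 6) (b := 3 * X)
    (f := fun y => e y * ((g y / y : ℝ) : ℂ))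
    (f' := fun y => Complex.I * t * (e y * ((g y / y : ℝ) : ℂ)) + e y * (h' y : ℂ))
    (fun y hy => by
      have hd : HasDerivAt g (deriv g y) y :=
        (hg.differentiable one_ne_zero y).hasDerivAt
      refine ((hasDerivAt_exp_I_mul_mul t y).mul
        ((hd.div (hasDerivAt_id' y) (hpos y hy).ne').ofReal_comp)).congr_deriv ?_
      rw [mul_assoc]
      rfl) (hi1.add hi2)
  rw [intervalIntegral.integral_add hi1 hi2, intervalIntegral.integral_const_mul] at hftc
  have z1 : g (X / 6) = 0 := eq_zero_of_support_subset_Icc_s17 hs fun h => by linarith [h.1]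
  have z2 : g (3 * X) = 0 := eq_zero_of_support_subset_Icc_s17 hs fun h => by linarith [h.2]
  simp only [z1, z2, zero_div, Complex.ofReal_zero, mul_zero, sub_zero] at hftc
  have hnorm : |t| * ‖∫ y in (X / 6)..(3 * X), e y * ((g y / y : ℝ) : ℂ)‖ =
      ‖∫ y in (X / 6)..(3 * X), e y * (h' y : ℂ)‖ := by
    rw [← norm_neg (∫ y in (X / 6)..(3 * X), e y * (h' y : ℂ)),
      ← eq_neg_of_add_eq_zero_left hftc]
    simp
  have hbound : ‖∫ y in (X / 6)..(3 * X), e y * (h' y : ℂ)‖ ≤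
      ∫ y in (X / 6)..(3 * X), (6 / X * |deriv g y| + 36 / X ^ 2) := by
    refine intervalIntegral.norm_integral_le_of_norm_le hle
      (Filter.Eventually.of_forall fun y hy => ?_)
      (((hg'.abs.const_mul _).add continuous_const).intervalIntegrable _ _)
    have hy0 : 0 < y := by linarith [hy.1]
    have h1 : 1 / y ≤ 6 / X := by
      rw [div_le_div_iff₀ hy0 hX]
      linarith [hy.1]
    have h2 : h' y = 1 / y * deriv g y - (1 / y) ^ 2 * g y := by
      simp only [hh']
      field_simp
    rw [norm_mul, he, norm_exp_I_mul_mul, one_mul, Complex.norm_real, Real.norm_eq_abs, h2]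
    refine (abs_sub _ _).trans ?_
    rw [abs_mul, abs_mul, abs_of_pos (by positivity : 0 < 1 / y),
      abs_of_pos (by positivity : 0 < (1 / y) ^ 2), abs_of_nonneg (h01 y).1]
    have h3 : (1 / y) ^ 2 * g y ≤ (6 / X) ^ 2 * 1 := by
      gcongr
      · exact (h01 y).1
      · exact (h01 y).2
    have h4 : (6 / X) ^ 2 * 1 = 36 / X ^ 2 := by ring
    have h5 : 1 / y * |deriv g y| ≤ 6 / X * |deriv g y| := by gcongr
    linarith
  rw [intervalIntegral.integral_add ((hg'.abs.const_mul _).intervalIntegrable _ _)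
    (by simp), intervalIntegral.integral_const_mul, intervalIntegral.integral_const,
    smul_eq_mul] at hbound
  have hV := intervalIntegral_abs_deriv_le hX hg hs hK
  simp only [← Complex.ofReal_div]
  rw [mul_assoc, hnorm]
  calc X * ‖∫ y in (X / 6)..(3 * X), e y * (h' y : ℂ)‖
      ≤ X * (6 / X * K₀ + (3 * X - X / 6) * (36 / X ^ 2)) := by
        gcongr
        refine hbound.trans ?_
        gcongr
    _ = 6 * K₀ + 102 := by
        field_simp
        ring
    _ ≤ _ := by linarith

lemma norm_integral_exp_mul_div_le_div_s17 {X K₀ : ℝ} {g : ℝ → ℝ} (hX : 0 < X)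
    (h01 : ∀ x, g x ∈ Set.Icc (0 : ℝ) 1) (hg : ContDiff ℝ 1 g)
    (hs : Function.support g ⊆ Set.Icc (X / 3) (2 * X))
    (hK : (∫ x : ℝ, |deriv g x|) ≤ K₀) (t : ℝ) :
    ‖∫ y in (X / 6)..(3 * X), Complex.exp (Complex.I * t * y) * (g y / y)‖ ≤
      (6 * K₀ + 126) * (1 / (1 + X * |t|)) := by
  rw [mul_one_div, le_div_iff₀ (by positivity)]
  linarith [norm_integral_exp_mul_div_le hX h01 t,
    mul_norm_integral_exp_mul_div_le hX h01 hg hs hK t]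

lemma cos_mul_exp_eq (k : ℕ) (α ξ y : ℝ) :
    (Real.cos (y * Real.sin ξ - k * ξ) : ℂ) * Complex.exp (Complex.I * α * y) =
      1 / 2 * (Complex.exp (-(Complex.I * (k * ξ))) *
          Complex.exp (Complex.I * ((α + Real.sin ξ : ℝ) : ℂ) * y) +
        Complex.exp (Complex.I * (k * ξ)) *
          Complex.exp (Complex.I * ((α - Real.sin ξ : ℝ) : ℂ) * y)) := by
  rw [Complex.ofReal_cos, Complex.cos, div_mul_eq_mul_div, add_mul, ← Complex.exp_add,
    ← Complex.exp_add, ← Complex.exp_add, ← Complex.exp_add]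
  push_cast
  ring_nf

lemma integral_besselJ_mul_eq {X : ℝ} {g : ℝ → ℝ} (hX : 0 < X) (hg : Continuous g)
    (hs : Function.support g ⊆ Set.Icc (X / 3) (2 * X)) (α : ℝ) (k : ℕ) :
    ∫ y in Set.Ioi (0:ℝ), (besselJ k y : ℂ) * Complex.exp (Complex.I * α * y) * (g y / y) =
      1 / (2 * Real.pi) * ∫ ξ in (0:ℝ)..(2 * Real.pi), ∫ y in (X / 6)..(3 * X),
        (Real.cos (y * Real.sin ξ - k * ξ) : ℂ) * Complex.exp (Complex.I * α * y) * (g y / y) := by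
  have hcont := continuous_div_id_of_support_subset hX hg hs
  have hcont' : Continuous fun y : ℝ => (g y / y : ℂ) := by
    simpa only [Complex.ofReal_div] using Complex.continuous_ofReal.comp' hcont
  rw [MeasureTheory.setIntegral_eq_of_subset_of_forall_sdiff_eq_zero (s := Set.Ioc (X / 6) (3 * X))
    measurableSet_Ioi (fun y hy => lt_of_le_of_lt (by positivity) hy.1) fun y hy => by
      have : g y = 0 := eq_zero_of_support_subset_Icc_s17 hs fun h =>
        hy.2 ⟨by linarith [h.1], by linarith [h.2]⟩
      simp [this], ← intervalIntegral.integral_of_le (by linarith),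
    MeasureTheory.intervalIntegral_intervalIntegral_swap,
    ← intervalIntegral.integral_const_mul]
  · refine intervalIntegral.integral_congr fun y _ => ?_
    simp only [besselJ]
    rw [Complex.ofReal_mul, ← intervalIntegral.integral_ofReal]
    simp only [intervalIntegral.integral_mul_const]
    push_cast
    ring
  · refine (ContinuousOn.integrableOn_compact (isCompact_uIcc.prod isCompact_uIcc) ?_).mono_set
      (Set.prod_mono Set.uIoc_subset_uIcc Set.uIoc_subset_uIcc)
    refine Continuous.continuousOn ?_
    simp only [Function.uncurry_def]
    have := hcont'.comp (continuous_snd (X := ℝ))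
    simp only [Function.comp_def] at this
    fun_prop

lemma norm_intervalIntegral_cos_mul_le {X K₀ : ℝ} {g : ℝ → ℝ} (hX : 0 < X)
    (h01 : ∀ x, g x ∈ Set.Icc (0 : ℝ) 1) (hg : ContDiff ℝ 1 g)
    (hs : Function.support g ⊆ Set.Icc (X / 3) (2 * X))
    (hK : (∫ x : ℝ, |deriv g x|) ≤ K₀) (α ξ : ℝ) (k : ℕ) :
    ‖∫ y in (X / 6)..(3 * X),
        (Real.cos (y * Real.sin ξ - k * ξ) : ℂ) * Complex.exp (Complex.I * α * y) * (g y / y)‖ ≤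
      (6 * K₀ + 126) / 2 * (1 / (1 + X * |α + Real.sin ξ|) + 1 / (1 + X * |-α + Real.sin ξ|)) := by
  have hcont' : Continuous fun y : ℝ => (g y / y : ℂ) := by
    simpa only [Complex.ofReal_div] using Complex.continuous_ofReal.comp'
      (continuous_div_id_of_support_subset hX hg.continuous hs)
  have hi : ∀ c t : ℂ, IntervalIntegrable
      (fun y : ℝ => c * (Complex.exp (Complex.I * t * y) * (g y / y)))
      MeasureTheory.volume (X / 6) (3 * X) := fun c t =>
    Continuous.intervalIntegrable (by fun_prop) _ _
  have hk : ‖Complex.exp (Complex.I * (k * ξ))‖ = 1 := by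
    simpa [mul_assoc] using norm_exp_I_mul_mul k ξ
  have hk' : ‖Complex.exp (-(Complex.I * (k * ξ)))‖ = 1 := by
    rw [Complex.exp_neg, norm_inv, hk, inv_one]
  have h1 := norm_integral_exp_mul_div_le_div_s17 hX h01 hg hs hK (α + Real.sin ξ)
  have h2 := norm_integral_exp_mul_div_le_div_s17 hX h01 hg hs hK (α - Real.sin ξ)
  rw [show |α - Real.sin ξ| = |-α + Real.sin ξ| by rw [← abs_neg]; ring_nf] at h2
  simp only [cos_mul_exp_eq]
  simp only [mul_assoc, add_mul] at h1 h2 hi ⊢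
  rw [intervalIntegral.integral_const_mul, intervalIntegral.integral_add (hi _ _) (hi _ _),
    intervalIntegral.integral_const_mul, intervalIntegral.integral_const_mul, norm_mul]
  refine (mul_le_mul_of_nonneg_left (norm_add_le _ _) (norm_nonneg _)).trans ?_
  rw [norm_mul, norm_mul, hk, hk']
  norm_num at h1 h2 ⊢
  linarith

theorem bessel_transform_bound_small_alpha :
    ∀ K₀ : ℝ, 0 < K₀ → ∃ K : ℝ, 0 < K ∧
      ∀ (X α : ℝ) (k : ℕ) (g : ℝ → ℝ), 0 < X → α ∈ Set.Icc (-1 : ℝ) 1 →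
        (∀ x : ℝ, g x ∈ Set.Icc (0 : ℝ) 1) →
        ContDiff ℝ 1 g →
        Function.support g ⊆ Set.Icc (X / 3) (2 * X) →
        (∫ x : ℝ, |deriv g x|) ≤ K₀ →
        ‖∫ y in Set.Ioi (0:ℝ),
            (besselJ k y : ℂ) * Complex.exp (Complex.I * α * y) * (g y / y)‖ ≤
          K * (1 + |Real.log X|) /
            (1 + X ^ ((1:ℝ)/2) + (1 - α ^ 2) ^ ((1:ℝ)/2) * X) := by
  intro K₀ hK₀
  refine ⟨20 * (6 * K₀ + 126), by positivity, fun X α k g hX hα h01 hg hs hK => ?_⟩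
  have hpi := Real.pi_pos
  rw [← Real.sqrt_eq_rpow, ← Real.sqrt_eq_rpow, ← Real.cos_arcsin, le_div_iff₀ (by
    have := Real.cos_arcsin_nonneg α
    positivity), integral_besselJ_mul_eq hX hg.continuous hs, norm_mul]
  have hF := weight_mul_integral_le hX (Real.arcsin α) (Real.cos_arcsin_nonneg α)
  have hF' := weight_mul_integral_le hX (-Real.arcsin α)
    (by rw [Real.cos_neg]; exact Real.cos_arcsin_nonneg α)
  rw [Real.cos_neg, Real.sin_neg] at hF'
  rw [Real.sin_arcsin hα.1 hα.2] at hF hF'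
  have hi : ∀ β : ℝ, IntervalIntegrable (fun ξ => 1 / (1 + X * |β + Real.sin ξ|))
      MeasureTheory.volume 0 (2 * Real.pi) := fun β =>
    (continuous_div_one_add_mul_abs hX.le (by fun_prop) 1).intervalIntegrable _ _
  have hI := intervalIntegral.norm_integral_le_of_norm_le (by positivity : 0 ≤ 2 * Real.pi)
    (Filter.Eventually.of_forall fun ξ _ =>
      norm_intervalIntegral_cos_mul_le hX h01 hg hs hK α ξ k)
    (((hi α).add (hi (-α))).const_mul ((6 * K₀ + 126) / 2))
  rw [intervalIntegral.integral_const_mul, intervalIntegral.integral_add (hi _) (hi _)] at hI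
  have hn : ‖(1 / (2 * Real.pi) : ℂ)‖ = 1 / (2 * Real.pi) := by
    simp [abs_of_pos hpi]
  rw [hn]
  have hc := Real.cos_arcsin_nonneg α
  set D := 1 + √X + Real.cos (Real.arcsin α) * X
  have hD : 0 ≤ D := by positivity
  set C := 6 * K₀ + 126
  have hC : 0 ≤ C := by positivity
  calc _ ≤ 1 / (2 * Real.pi) * (C / 2 *
        ((∫ ξ in (0:ℝ)..(2 * Real.pi), 1 / (1 + X * |α + Real.sin ξ|)) +
        ∫ ξ in (0:ℝ)..(2 * Real.pi), 1 / (1 + X * |-α + Real.sin ξ|))) * D := by gcongr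
    _ = C / (4 * Real.pi) * (D * (∫ ξ in (0:ℝ)..(2 * Real.pi), 1 / (1 + X * |α + Real.sin ξ|)) +
        D * ∫ ξ in (0:ℝ)..(2 * Real.pi), 1 / (1 + X * |-α + Real.sin ξ|)) := by
        field_simp
        ring
    _ ≤ C / (4 * Real.pi) * (40 * Real.pi * (1 + |Real.log X|) +
        40 * Real.pi * (1 + |Real.log X|)) := by gcongr
    _ = _ := by
        field_simp
        ring
end

section
/- For every K₀ > 0 there exists a constant K > 0 such that the following holds. Let X > 0, let α be a real number with |α| ≥ 1, let k ≥ 0 be an integer, and let g : ℝ → [0,1] be a continuously differentiable function with support contained in [X/3, 2X] and ∫_ℝ |g'(x)| dx ≤ K₀. Define J_k(y) = (1/(2π)) ∫_0^{2π} cos( y·sin ξ − k·ξ ) dξ. Then |∫_0^∞ J_k(y)·e^{iαy}·g(y) · dy/y| ≤ K·(1 + |log X|) / ( 1 + X^{1/2} + (α²−1)^{1/2}·X ). -/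
open MeasureTheory Set

lemma add_mul_sin_pos {A B : ℝ} (h : |B| < A) (x : ℝ) : 0 < A + B * Real.sin x := by
  have h1 : |B * Real.sin x| ≤ |B| := by
    rw [abs_mul]
    exact mul_le_of_le_one_right (abs_nonneg _) (Real.abs_sin_le_one x)
  linarith [neg_abs_le (B * Real.sin x)]

lemma integral_one_div_add_mul_sin {A B : ℝ} (h : |B| < A) :
    ∫ x in (0:ℝ)..(2 * Real.pi), 1 / (A + B * Real.sin x) =
      2 * Real.pi / Real.sqrt (A ^ 2 - B ^ 2) := by
  have hA : 0 < A := (abs_nonneg B).trans_lt h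
  have hD : 0 < A ^ 2 - B ^ 2 := by
    have := sq_lt_sq' (by linarith [abs_nonneg B]) h
    rw [sq_abs] at this
    linarith
  set S := Real.sqrt (A ^ 2 - B ^ 2) with hS
  have hSpos : 0 < S := Real.sqrt_pos.2 hD
  have hS2 : S ^ 2 = A ^ 2 - B ^ 2 := Real.sq_sqrt hD.le
  have hpos := add_mul_sin_pos h
  have hderiv : ∀ x ∈ uIcc 0 (2 * Real.pi), HasDerivAt
      (fun x => (x + 2 * Real.arctan (B * Real.cos x / (A + S + B * Real.sin x))) / S)
      (1 / (A + B * Real.sin x)) x := by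
    intro x _
    have hq : A + S + B * Real.sin x ≠ 0 := by linarith [hpos x]
    have hc := (Real.hasDerivAt_cos x).const_mul B
    have hs := ((Real.hasDerivAt_sin x).const_mul B).const_add (A + S)
    refine (((hasDerivAt_id x).add ((hc.div hs hq).arctan.const_mul 2)).div_const S).congr_deriv ?_
    have h0 := (hpos x).ne'
    have hsc := Real.sin_sq_add_cos_sq x
    have h2 : (A + S + B * Real.sin x) ^ 2 + (B * Real.cos x) ^ 2 =
        2 * (A + S) * (A + B * Real.sin x) := by
      linear_combination hS2 + B ^ 2 * hsc
    have h3 : 1 + (B * Real.cos x / (A + S + B * Real.sin x)) ^ 2 =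
        2 * (A + S) * (A + B * Real.sin x) / (A + S + B * Real.sin x) ^ 2 := by
      rw [← h2]; field_simp
    have hAS : A + S ≠ 0 := by positivity
    simp only [Pi.div_apply]
    rw [h3]
    field_simp
    linear_combination (-B ^ 2) * hsc - hS2
  rw [intervalIntegral.integral_eq_sub_of_hasDerivAt hderiv]
  · simp only [Real.cos_two_pi, Real.sin_two_pi, Real.cos_zero, Real.sin_zero]
    ring
  · exact (continuous_const.div (by fun_prop) fun x => (hpos x).ne').intervalIntegrable _ _

lemma abs_mul_norm_integral_exp_mul_le {a b : ℝ} (hab : a ≤ b) {w w' : ℝ → ℝ}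
    (hw : ∀ y ∈ Icc a b, HasDerivAt w (w' y) y) (hw' : ContinuousOn w' (Icc a b))
    (ha : w a = 0) (hb : w b = 0) (t : ℝ) :
    |t| * ‖∫ y in a..b, Complex.exp (Complex.I * t * y) * (w y : ℂ)‖ ≤ ∫ y in a..b, |w' y| := by
  have hu : uIcc a b = Icc a b := uIcc_of_le hab
  have he : ∀ y : ℝ, HasDerivAt (fun y : ℝ => Complex.exp (Complex.I * t * y))
      (Complex.I * t * Complex.exp (Complex.I * t * y)) y := by
    intro y
    have := ((hasDerivAt_id (y : ℂ)).const_mul (Complex.I * t)).cexp.comp_ofReal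
    simpa [mul_comm] using this
  have hparts := intervalIntegral.integral_mul_deriv_eq_deriv_mul (a := a) (b := b)
    (u := fun y => (w y : ℂ)) (u' := fun y => (w' y : ℂ))
    (fun y hy => (hw y (hu ▸ hy)).ofReal_comp) (fun y _ => he y)
    (Complex.continuous_ofReal.comp_continuousOn (hu ▸ hw')).intervalIntegrable
    ((by fun_prop : Continuous fun y : ℝ =>
      Complex.I * t * Complex.exp (Complex.I * t * y)).intervalIntegrable _ _)
  have hnorm : ∀ y : ℝ, ‖Complex.exp (Complex.I * t * y)‖ = 1 := by
    intro y
    rw [show Complex.I * t * y = ((t * y : ℝ) : ℂ) * Complex.I by push_cast; ring]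
    exact Complex.norm_exp_ofReal_mul_I _
  calc |t| * ‖∫ y in a..b, Complex.exp (Complex.I * t * y) * (w y : ℂ)‖
      = ‖∫ y in a..b, (w y : ℂ) * (Complex.I * t * Complex.exp (Complex.I * t * y))‖ := by
        rw [← Real.norm_eq_abs, ← Complex.norm_real, ← one_mul ‖(t : ℂ)‖, ← Complex.norm_I,
          ← norm_mul, ← norm_mul, ← intervalIntegral.integral_const_mul]
        congr 1
        refine intervalIntegral.integral_congr fun y _ => ?_
        ring
    _ = ‖∫ y in a..b, (w' y : ℂ) * Complex.exp (Complex.I * t * y)‖ := by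
        rw [hparts, ha, hb]; simp
    _ ≤ ∫ y in a..b, ‖(w' y : ℂ) * Complex.exp (Complex.I * t * y)‖ :=
        intervalIntegral.norm_integral_le_integral_norm hab
    _ = ∫ y in a..b, |w' y| := by
        simp only [norm_mul, hnorm, mul_one, Complex.norm_real, Real.norm_eq_abs]

lemma norm_integral_exp_mul_le {a b : ℝ} (hab : a ≤ b) (w : ℝ → ℝ) (t : ℝ) :
    ‖∫ y in a..b, Complex.exp (Complex.I * t * y) * (w y : ℂ)‖ ≤ ∫ y in a..b, |w y| := by
  refine (intervalIntegral.norm_integral_le_integral_norm hab).trans_eq ?_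
  refine intervalIntegral.integral_congr fun y _ => ?_
  simp only [norm_mul, Complex.norm_real, Real.norm_eq_abs]
  rw [show Complex.I * t * y = ((t * y : ℝ) : ℂ) * Complex.I by push_cast; ring,
    Complex.norm_exp_ofReal_mul_I, one_mul]

lemma besselJ_eq_integral_exp (k : ℕ) (y : ℝ) :
    (besselJ k y : ℂ) = 1 / (4 * Real.pi) * ∫ ξ in (0:ℝ)..(2 * Real.pi),
      (Complex.exp (-(Complex.I * k * ξ)) * Complex.exp (Complex.I * Real.sin ξ * y) +
        Complex.exp (Complex.I * k * ξ) * Complex.exp (-(Complex.I * Real.sin ξ * y))) := by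
  rw [besselJ]
  push_cast
  rw [← intervalIntegral.integral_ofReal, ← intervalIntegral.integral_const_mul,
    ← intervalIntegral.integral_const_mul]
  refine intervalIntegral.integral_congr fun ξ _ => ?_
  rw [← Complex.exp_add, ← Complex.exp_add, Complex.ofReal_cos, Complex.cos]
  push_cast
  rw [show ((y : ℂ) * Complex.sin ξ - k * ξ) * Complex.I =
      -(Complex.I * k * ξ) + Complex.I * Complex.sin ξ * y by ring,
    show -((y : ℂ) * Complex.sin ξ - k * ξ) * Complex.I =
      Complex.I * k * ξ + -(Complex.I * Complex.sin ξ * y) by ring]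
  field_simp
  ring

lemma integral_besselJ_mul_exp_mul {a b : ℝ} (hab : a ≤ b) {w : ℝ → ℝ}
    (hw : ContinuousOn w (Icc a b)) (k : ℕ) (α : ℝ) :
    ∫ y in a..b, (besselJ k y : ℂ) * Complex.exp (Complex.I * α * y) * (w y : ℂ) =
      1 / (4 * Real.pi) * ∫ ξ in (0:ℝ)..(2 * Real.pi),
        (Complex.exp (-(Complex.I * k * ξ)) *
          (∫ y in a..b, Complex.exp (Complex.I * ((α + 1 * Real.sin ξ : ℝ) : ℂ) * y) * (w y : ℂ)) +
        Complex.exp (Complex.I * k * ξ) *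
          ∫ y in a..b, Complex.exp (Complex.I * ((α + -1 * Real.sin ξ : ℝ) : ℂ) * y) * (w y : ℂ)) := by
  have hu : uIcc a b = Icc a b := uIcc_of_le hab
  have hwc : ContinuousOn (fun y => (w y : ℂ)) (uIcc a b) :=
    Complex.continuous_ofReal.comp_continuousOn (hu ▸ hw)
  let F : ℝ → ℝ → ℂ := fun y ξ =>
    (Complex.exp (-(Complex.I * k * ξ)) *
        Complex.exp (Complex.I * ((α + 1 * Real.sin ξ : ℝ) : ℂ) * y) +
      Complex.exp (Complex.I * k * ξ) *
        Complex.exp (Complex.I * ((α + -1 * Real.sin ξ : ℝ) : ℂ) * y)) * (w y : ℂ)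
  have hF : ContinuousOn (Function.uncurry F) (uIcc a b ×ˢ uIcc 0 (2 * Real.pi)) := by
    refine ContinuousOn.mul (Continuous.continuousOn (by fun_prop)) ?_
    exact hwc.comp continuousOn_fst fun p hp => hp.1
  have hFint : IntegrableOn (Function.uncurry F) (uIoc a b ×ˢ uIoc 0 (2 * Real.pi)) :=
    (hF.integrableOn_compact (isCompact_uIcc.prod isCompact_uIcc)).mono_set
      (prod_mono uIoc_subset_uIcc uIoc_subset_uIcc)
  have h1 : ∫ y in a..b, (besselJ k y : ℂ) * Complex.exp (Complex.I * α * y) * (w y : ℂ) =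
      1 / (4 * Real.pi) * ∫ y in a..b, ∫ ξ in (0:ℝ)..(2 * Real.pi), F y ξ := by
    rw [← intervalIntegral.integral_const_mul]
    refine intervalIntegral.integral_congr fun y _ => ?_
    rw [besselJ_eq_integral_exp, mul_assoc, mul_assoc, ← intervalIntegral.integral_mul_const]
    congr 1
    refine intervalIntegral.integral_congr fun ξ _ => ?_
    simp only [F]
    rw [show Complex.I * ((α + 1 * Real.sin ξ : ℝ) : ℂ) * y =
        Complex.I * Real.sin ξ * y + Complex.I * α * y by push_cast; ring,
      show Complex.I * ((α + -1 * Real.sin ξ : ℝ) : ℂ) * y =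
        -(Complex.I * Real.sin ξ * y) + Complex.I * α * y by push_cast; ring,
      Complex.exp_add _ (Complex.I * α * y), Complex.exp_add _ (Complex.I * α * y)]
    ring
  rw [h1, intervalIntegral_intervalIntegral_swap hFint]
  congr 1
  refine intervalIntegral.integral_congr fun ξ _ => ?_
  have hi : ∀ t : ℝ, IntervalIntegrable
      (fun y : ℝ => Complex.exp (Complex.I * t * y) * (w y : ℂ)) volume a b := fun t =>
    (ContinuousOn.mul (Continuous.continuousOn (by fun_prop)) hwc).intervalIntegrable
  rw [← intervalIntegral.integral_const_mul, ← intervalIntegral.integral_const_mul,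
    ← intervalIntegral.integral_add ((hi _).const_mul _) ((hi _).const_mul _)]
  refine intervalIntegral.integral_congr fun y _ => ?_
  simp only [F]
  ring

/-- If the Fourier transform of `w` on `[a, b]` decays like `1 / (1 + X|t|)`, averaging it against
the circle at frequencies `α ± sin ξ` gains the factor coming from the Poisson kernel. -/
lemma norm_integral_besselJ_mul_exp_mul_le {a b : ℝ} (hab : a ≤ b) {w : ℝ → ℝ}
    (hw : ContinuousOn w (Icc a b)) (k : ℕ) {α X C : ℝ} (hX : 0 < X) (hα : 1 ≤ |α|)
    (hC : ∀ t : ℝ, (1 + X * |t|) *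
      ‖∫ y in a..b, Complex.exp (Complex.I * t * y) * (w y : ℂ)‖ ≤ C) :
    ‖∫ y in a..b, (besselJ k y : ℂ) * Complex.exp (Complex.I * α * y) * (w y : ℂ)‖ ≤
      C / Real.sqrt ((1 + X * |α|) ^ 2 - X ^ 2) := by
  rw [integral_besselJ_mul_exp_mul hab hw]
  set A := 1 + X * |α| with hA
  have hXA : |X| < A := by rw [abs_of_pos hX]; nlinarith
  have hXA' : |-X| < A := by rwa [abs_neg]
  have hΦ : ∀ ε : ℝ, |ε| = 1 → ∃ B : ℝ, (B = X ∨ B = -X) ∧ ∀ ξ : ℝ,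
      ‖∫ y in a..b, Complex.exp (Complex.I * ((α + ε * Real.sin ξ : ℝ) : ℂ) * y) * (w y : ℂ)‖ ≤
        C * (1 / (A + B * Real.sin ξ)) := by
    intro ε hε
    obtain ⟨σ, hσ, hασ⟩ : ∃ σ : ℝ, (σ = 1 ∨ σ = -1) ∧ |α| = σ * α := by
      rcases abs_choice α with h | h
      · exact ⟨1, by simp, by simpa using h⟩
      · exact ⟨-1, by simp, by simpa using h⟩
    have hB : X * σ * ε = X ∨ X * σ * ε = -X := by
      rcases hσ with rfl | rfl <;> rcases eq_or_eq_neg_of_abs_eq hε with rfl | rfl <;> simp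
    refine ⟨X * σ * ε, hB, fun ξ => ?_⟩
    have hpos : 0 < A + X * σ * ε * Real.sin ξ :=
      add_mul_sin_pos (by rcases hB with h | h <;> rwa [h]) ξ
    rw [mul_one_div, le_div_iff₀ hpos, mul_comm]
    refine le_trans (mul_le_mul_of_nonneg_right ?_ (norm_nonneg _)) (hC _)
    have hle : σ * (α + ε * Real.sin ξ) ≤ |α + ε * Real.sin ξ| := by
      rcases hσ with rfl | rfl
      · simpa using le_abs_self _
      · simpa using neg_le_abs (α + ε * Real.sin ξ)
    rw [hA, hασ]
    nlinarith
  obtain ⟨B₁, hB₁, h₁⟩ := hΦ 1 (by simp)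
  obtain ⟨B₂, hB₂, h₂⟩ := hΦ (-1) (by simp)
  have hB : ∀ B, (B = X ∨ B = -X) → |B| < A ∧ B ^ 2 = X ^ 2 := by
    rintro B (rfl | rfl) <;> simp_all
  obtain ⟨hA₁, hq₁⟩ := hB B₁ hB₁
  obtain ⟨hA₂, hq₂⟩ := hB B₂ hB₂
  have hFint : ∀ B, |B| < A → IntervalIntegrable
      (fun ξ => C * (1 / (A + B * Real.sin ξ))) volume 0 (2 * Real.pi) := fun B hB =>
    (continuous_const.mul (continuous_const.div (by fun_prop)
      fun x => (add_mul_sin_pos hB x).ne')).intervalIntegrable _ _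
  have hexp : ∀ ξ : ℝ, ‖Complex.exp (Complex.I * k * ξ)‖ = 1 ∧
      ‖Complex.exp (-(Complex.I * k * ξ))‖ = 1 := by
    intro ξ
    rw [show -(Complex.I * k * ξ) = ((-(k * ξ) : ℝ) : ℂ) * Complex.I by push_cast; ring,
      show Complex.I * k * ξ = ((k * ξ : ℝ) : ℂ) * Complex.I by push_cast; ring]
    exact ⟨Complex.norm_exp_ofReal_mul_I _, Complex.norm_exp_ofReal_mul_I _⟩
  have hbound := intervalIntegral.norm_integral_le_of_norm_le (μ := volume)
    (Real.two_pi_pos.le) (f := fun ξ : ℝ => Complex.exp (-(Complex.I * k * ξ)) *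
          (∫ y in a..b, Complex.exp (Complex.I * ((α + 1 * Real.sin ξ : ℝ) : ℂ) * y) * (w y : ℂ)) +
        Complex.exp (Complex.I * k * ξ) *
          ∫ y in a..b, Complex.exp (Complex.I * ((α + -1 * Real.sin ξ : ℝ) : ℂ) * y) * (w y : ℂ))
    (Filter.Eventually.of_forall fun ξ _ => ?_) ((hFint B₁ hA₁).add (hFint B₂ hA₂))
  · rw [norm_mul]
    refine (mul_le_mul_of_nonneg_left hbound (norm_nonneg _)).trans_eq ?_
    rw [intervalIntegral.integral_add (hFint B₁ hA₁) (hFint B₂ hA₂),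
      intervalIntegral.integral_const_mul, intervalIntegral.integral_const_mul,
      integral_one_div_add_mul_sin hA₁, integral_one_div_add_mul_sin hA₂, hq₁, hq₂]
    have : ‖(1 / (4 * Real.pi) : ℂ)‖ = 1 / (4 * Real.pi) := by
      rw [show (1 / (4 * Real.pi) : ℂ) = ((1 / (4 * Real.pi) : ℝ) : ℂ) by push_cast; ring,
        Complex.norm_real, Real.norm_eq_abs, abs_of_pos (by positivity)]
    rw [this]
    field_simp
    ring
  · refine (norm_add_le _ _).trans (add_le_add ?_ ?_)
    · rw [norm_mul, (hexp ξ).2, one_mul]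
      exact h₁ ξ
    · rw [norm_mul, (hexp ξ).1, one_mul]
      exact h₂ ξ

lemma one_add_sqrt_add_le {X α : ℝ} (hX : 0 < X) (hα : 1 ≤ |α|) :
    1 + X ^ ((1:ℝ)/2) + (α ^ 2 - 1) ^ ((1:ℝ)/2) * X ≤
      3 * Real.sqrt ((1 + X * |α|) ^ 2 - X ^ 2) := by
  rw [← Real.sqrt_eq_rpow, ← Real.sqrt_eq_rpow]
  have hα2 : 0 ≤ α ^ 2 - 1 := by
    rw [← sq_abs]; nlinarith
  have hD : (1 + X * |α|) ^ 2 - X ^ 2 = 1 + 2 * (X * |α|) + (α ^ 2 - 1) * X ^ 2 := by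
    rw [← sq_abs α]; ring
  have hXα : X ≤ X * |α| := le_mul_of_one_le_right hX.le hα
  have hnn : 0 ≤ (α ^ 2 - 1) * X ^ 2 := by positivity
  rw [hD]
  have h1 : 1 ≤ Real.sqrt (1 + 2 * (X * |α|) + (α ^ 2 - 1) * X ^ 2) :=
    Real.one_le_sqrt.2 (by linarith)
  have h2 : Real.sqrt X ≤ Real.sqrt (1 + 2 * (X * |α|) + (α ^ 2 - 1) * X ^ 2) :=
    Real.sqrt_le_sqrt (by linarith)
  have h3 : Real.sqrt (α ^ 2 - 1) * X ≤
      Real.sqrt (1 + 2 * (X * |α|) + (α ^ 2 - 1) * X ^ 2) := by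
    refine Real.le_sqrt_of_sq_le ?_
    rw [mul_pow, Real.sq_sqrt hα2]
    linarith
  linarith

lemma one_add_mul_abs_mul_norm_integral_exp_le {X K₀ : ℝ} (hX : 0 < X) {g : ℝ → ℝ}
    (hg : ∀ x, g x ∈ Icc (0 : ℝ) 1) (hgd : ContDiff ℝ 1 g)
    (hsupp : Function.support g ⊆ Icc (X / 3) (2 * X)) (hK : ∫ x : ℝ, |deriv g x| ≤ K₀) (t : ℝ) :
    (1 + X * |t|) * ‖∫ y in (X / 4)..(3 * X),
      Complex.exp (Complex.I * t * y) * ((g y / y : ℝ) : ℂ)‖ ≤ 4 * K₀ + 55 := by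
  have hab : X / 4 ≤ 3 * X := by linarith
  have hypos : ∀ y ∈ Icc (X / 4) (3 * X), 0 < y := fun y hy => by linarith [hy.1]
  have hgc : Continuous (deriv g) := hgd.continuous_deriv le_rfl
  have hcs : HasCompactSupport g := HasCompactSupport.intro isCompact_Icc fun x hx =>
    Function.notMem_support.1 fun h => hx (hsupp h)
  have hgint : Integrable fun x => |deriv g x| :=
    (hgc.integrable_of_hasCompactSupport hcs.deriv).abs
  have hz : ∀ y, (y < X / 3 ∨ 2 * X < y) → g y = 0 := fun y hy =>
    Function.notMem_support.1 fun h => by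
      have := hsupp h
      rcases hy with hy | hy <;> linarith [this.1, this.2]
  have hderiv : ∀ y ∈ Icc (X / 4) (3 * X),
      HasDerivAt (fun y => g y / y) ((deriv g y * y - g y * 1) / y ^ 2) y := fun y hy =>
    ((hgd.differentiable one_ne_zero).differentiableAt.hasDerivAt).div (hasDerivAt_id y)
      (hypos y hy).ne'
  have hcont : ContinuousOn (fun y => (deriv g y * y - g y * 1) / y ^ 2)
      (Icc (X / 4) (3 * X)) :=
    ContinuousOn.div
      ((hgc.mul continuous_id).sub (hgd.continuous.mul continuous_const)).continuousOn
      (by fun_prop) fun y hy => (pow_pos (hypos y hy) 2).ne'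
  have hwcont : ContinuousOn (fun y => g y / y) (Icc (X / 4) (3 * X)) :=
    fun y hy => (hderiv y hy).continuousAt.continuousWithinAt
  have hinv : ∀ y ∈ Icc (X / 4) (3 * X), 1 / y ≤ 4 / X := fun y hy => by
    rw [div_le_div_iff₀ (hypos y hy) hX]; linarith [hy.1]
  have hI : ∀ {f : ℝ → ℝ}, ContinuousOn f (Icc (X / 4) (3 * X)) →
      IntervalIntegrable f volume (X / 4) (3 * X) := fun hf =>
    (uIcc_of_le hab ▸ hf : ContinuousOn _ (uIcc (X / 4) (3 * X))).intervalIntegrable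
  have hmass : ∫ y in (X / 4)..(3 * X), |g y / y| ≤ 11 := by
    calc ∫ y in (X / 4)..(3 * X), |g y / y|
        ≤ ∫ _ in (X / 4)..(3 * X), 4 / X := by
          refine intervalIntegral.integral_mono_on hab (hI hwcont.abs) (by simp) fun y hy => ?_
          rw [abs_of_nonneg (div_nonneg (hg y).1 (hypos y hy).le)]
          exact (div_le_div_of_nonneg_right (hg y).2 (hypos y hy).le).trans (hinv y hy)
      _ = 11 := by
          rw [intervalIntegral.integral_const, smul_eq_mul]; field_simp; norm_num
  have hvar : ∫ y in (X / 4)..(3 * X), |(deriv g y * y - g y * 1) / y ^ 2| ≤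
      (4 * K₀ + 44) / X := by
    calc ∫ y in (X / 4)..(3 * X), |(deriv g y * y - g y * 1) / y ^ 2|
        ≤ ∫ y in (X / 4)..(3 * X), (4 / X * |deriv g y| + (4 / X) ^ 2) := by
          refine intervalIntegral.integral_mono_on hab (hI hcont.abs)
            (hI (by fun_prop)) fun y hy => ?_
          have hy0 := hypos y hy
          have h1 : (deriv g y * y - g y * 1) / y ^ 2 =
              1 / y * deriv g y - g y * (1 / y) ^ 2 := by field_simp
          rw [h1]
          refine (abs_sub _ _).trans (add_le_add ?_ ?_)
          · rw [abs_mul, abs_of_pos (one_div_pos.2 hy0)]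
            exact mul_le_mul_of_nonneg_right (hinv y hy) (abs_nonneg _)
          · rw [abs_of_nonneg (mul_nonneg (hg y).1 (sq_nonneg _))]
            exact (mul_le_of_le_one_left (sq_nonneg _) (hg y).2).trans
              (pow_le_pow_left₀ (one_div_pos.2 hy0).le (hinv y hy) 2)
      _ = 4 / X * (∫ y in (X / 4)..(3 * X), |deriv g y|) + 44 / X := by
          rw [intervalIntegral.integral_add (hI (by fun_prop)) (by simp),
            intervalIntegral.integral_const_mul, intervalIntegral.integral_const, smul_eq_mul]
          field_simp
          ring
      _ ≤ 4 / X * K₀ + 44 / X := by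
          gcongr
          refine le_trans ?_ hK
          rw [intervalIntegral.integral_of_le hab]
          exact setIntegral_le_integral hgint (Filter.Eventually.of_forall fun _ => abs_nonneg _)
      _ = (4 * K₀ + 44) / X := by ring
  have h1 := (norm_integral_exp_mul_le hab (fun y => g y / y) t).trans hmass
  have h2 := (abs_mul_norm_integral_exp_mul_le hab hderiv hcont
    (by simp [hz (X / 4) (Or.inl (by linarith))])
    (by simp [hz (3 * X) (Or.inr (by linarith))]) t).trans hvar
  rw [le_div_iff₀ hX] at h2
  linarith

theorem bessel_transform_bound_large_alpha :
    ∀ K₀ : ℝ, 0 < K₀ → ∃ K : ℝ, 0 < K ∧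
      ∀ (X α : ℝ) (k : ℕ) (g : ℝ → ℝ), 0 < X → 1 ≤ |α| →
        (∀ x : ℝ, g x ∈ Set.Icc (0 : ℝ) 1) →
        ContDiff ℝ 1 g →
        Function.support g ⊆ Set.Icc (X / 3) (2 * X) →
        (∫ x : ℝ, |deriv g x|) ≤ K₀ →
        ‖∫ y in Set.Ioi (0:ℝ),
            (besselJ k y : ℂ) * Complex.exp (Complex.I * α * y) * (g y / y)‖ ≤
          K * (1 + |Real.log X|) /
            (1 + X ^ ((1:ℝ)/2) + (α ^ 2 - 1) ^ ((1:ℝ)/2) * X) := by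
  intro K₀ hK₀
  refine ⟨3 * (4 * K₀ + 55), by positivity, fun X α k g hX hα hg hgd hsupp hK => ?_⟩
  have hab : X / 4 ≤ 3 * X := by linarith
  have hwcont : ContinuousOn (fun y => g y / y) (Icc (X / 4) (3 * X)) :=
    hgd.continuous.continuousOn.div continuousOn_id fun y hy => by
      have : 0 < y := by linarith [hy.1]
      exact this.ne'
  have hset : ∫ y in Ioi (0:ℝ),
        (besselJ k y : ℂ) * Complex.exp (Complex.I * α * y) * (g y / y) =
      ∫ y in (X / 4)..(3 * X),
        (besselJ k y : ℂ) * Complex.exp (Complex.I * α * y) * ((g y / y : ℝ) : ℂ) := by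
    rw [intervalIntegral.integral_of_le hab]
    simp only [Complex.ofReal_div]
    refine setIntegral_eq_of_subset_of_forall_sdiff_eq_zero measurableSet_Ioi
      (fun y hy => lt_trans (by positivity) hy.1) fun y hy => ?_
    have : g y = 0 := Function.notMem_support.1 fun h =>
      hy.2 ⟨by linarith [(hsupp h).1], by linarith [(hsupp h).2]⟩
    simp [this]
  rw [hset]
  refine (norm_integral_besselJ_mul_exp_mul_le hab hwcont k hX hα
    (one_add_mul_abs_mul_norm_integral_exp_le hX hg hgd hsupp hK)).trans ?_
  have hα2 : 0 ≤ α ^ 2 - 1 := by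
    rw [← sq_abs]; nlinarith
  have hden : 0 < 1 + X ^ ((1:ℝ)/2) + (α ^ 2 - 1) ^ ((1:ℝ)/2) * X := by positivity
  have hle := one_add_sqrt_add_le hX hα
  have hS : 0 < Real.sqrt ((1 + X * |α|) ^ 2 - X ^ 2) := by linarith
  rw [div_le_div_iff₀ hS hden]
  calc (4 * K₀ + 55) * (1 + X ^ ((1:ℝ)/2) + (α ^ 2 - 1) ^ ((1:ℝ)/2) * X)
      ≤ (4 * K₀ + 55) * (3 * Real.sqrt ((1 + X * |α|) ^ 2 - X ^ 2)) := by gcongr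
    _ = 3 * (4 * K₀ + 55) * 1 * Real.sqrt ((1 + X * |α|) ^ 2 - X ^ 2) := by ring
    _ ≤ 3 * (4 * K₀ + 55) * (1 + |Real.log X|) *
          Real.sqrt ((1 + X * |α|) ^ 2 - X ^ 2) := by
        gcongr
        linarith [abs_nonneg (Real.log X)]
end
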